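/- arXiv:2404.15755 — 3 statements merged into one kernel-verified Lean document; each statement's English description precedes it below -/
import Mathlib

section
/- Let (X,d,m) be an mm-space with supp m = X satisfying CD(K,N) for some K ∈ ℝ and N ∈ (1,∞), and let x₀ ∈ X. Define 𝔰_{K,N}(t) = sin(√(K/(N−1))·t) if K > 0, 𝔰_{K,N}(t) = t if K = 0, and 𝔰_{K,N}(t) = sinh(√(−K/(N−1))·t) if K < 0. Then for all 0 < r < R (with additionally R ≤ π√((N−1)/K) when K > 0): m(B_r(x₀))·∫₀^R 𝔰_{K,N}(t)^{N−1} dt ≥ m(B_R(x₀))·∫₀^r 𝔰_{K,N}(t)^{N−1} dt. -/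
open MeasureTheory Filter Set Topology ENNReal
open scoped Classical

noncomputable section

/-- A coupling of two measures. -/
def IsCoupling {α β : Type*} [MeasurableSpace α] [MeasurableSpace β]
    (q : Measure (α × β)) (μ : Measure α) (ν : Measure β) : Prop :=
  Measure.map Prod.fst q = μ ∧ Measure.map Prod.snd q = ν

/-- Membership in the Wasserstein space `P₂`. -/
def MemP2 {α : Type*} [MetricSpace α] [MeasurableSpace α] (μ : Measure α) : Prop :=
  IsProbabilityMeasure μ ∧ ∃ x₀ : α, ∫⁻ x, edist x x₀ ^ 2 ∂μ < ∞

/-- The squared Kantorovich–Wasserstein distance. -/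
def Wsq {α : Type*} [MetricSpace α] [MeasurableSpace α] (μ ν : Measure α) : ℝ≥0∞ :=
  ⨅ (q : Measure (α × α)) (_ : IsCoupling q μ ν), ∫⁻ p, edist p.1 p.2 ^ 2 ∂q

/-- The Kantorovich–Wasserstein distance `W₂`. -/
def W2 {α : Type*} [MetricSpace α] [MeasurableSpace α] (μ ν : Measure α) : ℝ≥0∞ :=
  Wsq μ ν ^ (1/2 : ℝ)

/-- A `W₂`-geodesic parametrized by `[0,1]`. -/
def IsW2Geodesic {α : Type*} [MetricSpace α] [MeasurableSpace α] (μ : ℝ → Measure α) : Prop :=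
  ∀ s ∈ Icc (0:ℝ) 1, ∀ t ∈ Icc (0:ℝ) 1,
    W2 (μ s) (μ t) = ENNReal.ofReal |s - t| * W2 (μ 0) (μ 1)

/-- Integrand of the Boltzmann entropy. -/
def entFun {α : Type*} [MeasurableSpace α] (μ m : Measure α) (x : α) : ℝ :=
  (μ.rnDeriv m x).toReal * Real.log (μ.rnDeriv m x).toReal

/-- Boltzmann entropy `Ent(μ|m)`. -/
def Ent {α : Type*} [MeasurableSpace α] (μ m : Measure α) : EReal :=
  if μ ≪ m ∧ Integrable (fun x => max (entFun μ m x) 0) m then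
    ((∫ x, max (entFun μ m x) 0 ∂m : ℝ) : EReal)
      - ((∫⁻ x, ENNReal.ofReal (-(entFun μ m x)) ∂m : ℝ≥0∞) : EReal)
  else ⊤

/-- The CD(K,∞) convexity inequality along some geodesic from `μ₀` to `μ₁`. -/
def CDinftyFor {α : Type*} [MetricSpace α] [MeasurableSpace α]
    (K : ℝ) (m μ₀ μ₁ : Measure α) : Prop :=
  ∃ μ : ℝ → Measure α, μ 0 = μ₀ ∧ μ 1 = μ₁ ∧ IsW2Geodesic μ ∧
    ∀ t ∈ Icc (0:ℝ) 1,
      Ent (μ t) m ≤ ((1 - t : ℝ) : EReal) * Ent μ₀ m + ((t : ℝ) : EReal) * Ent μ₁ m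
        - ((K/2 * (t * (1-t)) : ℝ) : EReal) * ((Wsq μ₀ μ₁ : ℝ≥0∞) : EReal)

/-- The curvature-dimension condition CD(K,∞). -/
def CDinfty {α : Type*} [MetricSpace α] [MeasurableSpace α] (K : ℝ) (m : Measure α) : Prop :=
  ∀ μ₀ μ₁ : Measure α, MemP2 μ₀ → MemP2 μ₁ → CDinftyFor K m μ₀ μ₁

/-- Distortion coefficients `τ^{(t)}_{K,N}(θ)`. -/
def tauCoef (K N t θ : ℝ) : ℝ≥0∞ :=
  if 0 < K then
    if Real.pi * Real.sqrt ((N-1)/K) ≤ θ then ∞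
    else ENNReal.ofReal (t ^ (1/N) *
      (Real.sin (Real.sqrt (K/(N-1)) * (t * θ)) / Real.sin (Real.sqrt (K/(N-1)) * θ)) ^ ((N-1)/N))
  else if K = 0 then ENNReal.ofReal t
  else ENNReal.ofReal (t ^ (1/N) *
      (Real.sinh (Real.sqrt (-K/(N-1)) * (t * θ)) / Real.sinh (Real.sqrt (-K/(N-1)) * θ)) ^ ((N-1)/N))

/-- The CD(K,N) inequality along some geodesic/optimal coupling from `μ₀` to `μ₁`,
with distortion coefficients `coef`. -/
def CDForWith {α : Type*} [MetricSpace α] [MeasurableSpace α]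
    (coef : ℝ → ℝ → ℝ≥0∞) (N : ℝ) (m μ₀ μ₁ : Measure α) : Prop :=
  ∃ (μ : ℝ → Measure α) (q : Measure (α × α)),
    μ 0 = μ₀ ∧ μ 1 = μ₁ ∧ IsW2Geodesic μ ∧ (∀ t ∈ Icc (0:ℝ) 1, μ t ≪ m) ∧
    IsCoupling q μ₀ μ₁ ∧ (∫⁻ p, edist p.1 p.2 ^ 2 ∂q) = Wsq μ₀ μ₁ ∧
    ∀ t ∈ Icc (0:ℝ) 1,
      ∫⁻ x, ((μ t).rnDeriv m x) ^ (1 - 1/N : ℝ) ∂m ≥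
      ∫⁻ p, coef (1-t) (dist p.1 p.2) * (μ₀.rnDeriv m p.1) ^ (-(1/N) : ℝ)
            + coef t (dist p.1 p.2) * (μ₁.rnDeriv m p.2) ^ (-(1/N) : ℝ) ∂q

def CDFor {α : Type*} [MetricSpace α] [MeasurableSpace α]
    (K N : ℝ) (m μ₀ μ₁ : Measure α) : Prop :=
  CDForWith (fun t θ => tauCoef K N t θ) N m μ₀ μ₁

/-- The curvature-dimension condition CD(K,N). -/
def CD {α : Type*} [MetricSpace α] [MeasurableSpace α] (K N : ℝ) (m : Measure α) : Prop :=
  ∀ μ₀ μ₁ : Measure α, MemP2 μ₀ → MemP2 μ₁ → μ₀ ≪ m → μ₁ ≪ m → CDFor K N m μ₀ μ₁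

/-- The support of a measure on a topological space. -/
def mmSupp {α : Type*} [TopologicalSpace α] [MeasurableSpace α] (μ : Measure α) : Set α :=
  {x | ∀ U ∈ nhds x, 0 < μ U}


/-- The model volume density `𝔰_{K,N}`. -/
def sKN (K N t : ℝ) : ℝ :=
  if 0 < K then Real.sin (Real.sqrt (K / (N-1)) * t)
  else if K = 0 then t
  else Real.sinh (Real.sqrt (-K / (N-1)) * t)

lemma bg_glue {X : Type*} [MeasurableSpace X] [StandardBorelSpace X] [Nonempty X]
    (q1 q2 : Measure (X × X)) [IsFiniteMeasure q1] [IsFiniteMeasure q2]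
    (h : Measure.map Prod.snd q1 = Measure.map Prod.fst q2) :
    ∃ π : Measure (X × X × X), Measure.map (fun p => (p.2.1, p.1)) π = q1 ∧
      Measure.map (fun p => (p.1, p.2.2)) π = q2 := by
  let q1' : Measure (X × X) := q1.map Prod.swap
  have hfin : IsFiniteMeasure q1' := by infer_instance
  have hfst : q1'.fst = q2.fst := by
    rw [Measure.fst, Measure.fst, ← h, Measure.map_map measurable_fst measurable_swap]
    rfl
  refine ⟨Measure.compProd q2.fst ((q1'.condKernel).prod q2.condKernel), ?_, ?_⟩
  · have e : (fun p : X × X × X => (p.2.1, p.1)) = Prod.swap ∘ Prod.map id Prod.fst := rfl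
    rw [e, ← Measure.map_map measurable_swap (by fun_prop),
      ← Measure.compProd_map measurable_fst, ← ProbabilityTheory.Kernel.fst_eq,
      ProbabilityTheory.Kernel.fst_prod, ← hfst, Measure.disintegrate,
      Measure.map_map measurable_swap measurable_swap]
    simp
  · have e : (fun p : X × X × X => (p.1, p.2.2)) = Prod.map id Prod.snd := rfl
    rw [e, ← Measure.compProd_map measurable_snd, ← ProbabilityTheory.Kernel.snd_eq,
      ProbabilityTheory.Kernel.snd_prod, Measure.disintegrate]

lemma bg_pointwise (t a b d : ℝ) (ht0 : 0 < t) (ht1 : t < 1)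
    (hd : 0 ≤ d) (h : d ≤ a + b) :
    (a - t * d) ^ 2 / 2 + d ^ 2 ≤ a ^ 2 / t + b ^ 2 / (1 - t) := by
  have h1 : 0 < 1 - t := by linarith
  have e : a ^ 2 / t + b ^ 2 / (1 - t) = (a + b) ^ 2 + ((1 - t) * a - t * b) ^ 2 / (t * (1 - t)) := by
    field_simp
    ring
  have h2 : 4 * ((1 - t) * a - t * b) ^ 2 ≤ ((1 - t) * a - t * b) ^ 2 / (t * (1 - t)) := by
    rw [le_div_iff₀ (by positivity)]
    nlinarith [sq_nonneg ((1 - t) * a - t * b), sq_nonneg (2 * t - 1),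
      mul_nonneg (sq_nonneg ((1 - t) * a - t * b)) (sq_nonneg (2 * t - 1))]
  rw [e]
  set u := (1 - t) * a - t * b with hu
  obtain ⟨v, hv⟩ : ∃ v, v = a + b - d := ⟨_, rfl⟩
  have hv0 : 0 ≤ v := by linarith
  have e2 : a - t * d = u + t * v := by rw [hu, hv]; ring
  have e3 : (a + b) ^ 2 = (v + d) ^ 2 := by rw [hv]; ring
  have h4 : (t * v) ^ 2 ≤ v ^ 2 := by
    apply sq_le_sq'
    · nlinarith
    · nlinarith
  rw [e2, e3]
  nlinarith [sq_nonneg (u - t * v), mul_nonneg hv0 hd, sq_nonneg u]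

lemma bg_ofReal_sq_dist {X : Type*} [MetricSpace X] (x y : X) :
    edist x y ^ 2 = ENNReal.ofReal (dist x y ^ 2) := by
  rw [edist_dist, ENNReal.ofReal_pow dist_nonneg]

lemma bg_pointwise' {X : Type*} [MetricSpace X] (t : ℝ) (ht0 : 0 < t) (ht1 : t < 1) (x y z : X) :
    ENNReal.ofReal ((dist x z - t * dist x y) ^ 2 / 2) + edist x y ^ 2
      ≤ ENNReal.ofReal (1 / t) * edist x z ^ 2 + ENNReal.ofReal (1 / (1 - t)) * edist z y ^ 2 := by
  have h1 : 0 < 1 - t := by linarith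
  rw [bg_ofReal_sq_dist, bg_ofReal_sq_dist, bg_ofReal_sq_dist,
    ← ENNReal.ofReal_add (by positivity) (by positivity),
    ← ENNReal.ofReal_mul (by positivity), ← ENNReal.ofReal_mul (by positivity),
    ← ENNReal.ofReal_add (by positivity) (by positivity)]
  apply ENNReal.ofReal_le_ofReal
  have := bg_pointwise t (dist x z) (dist z y) (dist x y) ht0 ht1 dist_nonneg (dist_triangle _ _ _)
  calc _ ≤ _ := this
    _ = _ := by ring

lemma bg_exists_coupling {X : Type*} [MetricSpace X] [MeasurableSpace X]
    (μ ν : Measure X) (A : ℝ≥0∞) (h : Wsq μ ν < A) :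
    ∃ q, IsCoupling q μ ν ∧ ∫⁻ p, edist p.1 p.2 ^ 2 ∂q < A := by
  unfold Wsq at h
  simp only [iInf_lt_iff] at h
  obtain ⟨q, hq, h⟩ := h
  exact ⟨q, hq, h⟩

lemma bg_prob_of_coupling {X : Type*} [MeasurableSpace X]
    (q : Measure (X × X)) (μ ν : Measure X) (h : IsCoupling q μ ν) :
    q univ = μ univ ∧ q univ = ν univ := by
  constructor
  · rw [← h.1, Measure.map_apply measurable_fst MeasurableSet.univ]; rfl
  · rw [← h.2, Measure.map_apply measurable_snd MeasurableSet.univ]; rfl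

lemma bg_support {X : Type*} [MetricSpace X] [SecondCountableTopology X] [CompleteSpace X]
    [MeasurableSpace X] [BorelSpace X]
    (x₀ : X) (μ0 μt μ1 : Measure X) [IsProbabilityMeasure μ0]
    (t : ℝ) (ht0 : 0 < t) (ht1 : t < 1) (W : ℝ≥0∞) (hW : W ≠ ∞) (hW01 : Wsq μ0 μ1 = W)
    (hW0 : Wsq μ0 μt = ENNReal.ofReal (t ^ 2) * W)
    (hW1 : Wsq μt μ1 = ENNReal.ofReal ((1 - t) ^ 2) * W)
    (ε : ℝ) (hε : 0 < ε) (C : Set ℝ)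
    (h0 : ∀ᵐ x ∂μ0, dist x x₀ < ε) (h1 : ∀ᵐ x ∂μ1, dist x x₀ ∈ C) :
    μt univ = 1 ∧ ∀ᵐ z ∂μt, dist z x₀ ∈ Metric.cthickening (3 * ε) ((fun c => t * c) '' C) := by
  have ht1' : 0 < 1 - t := by linarith
  have : Nonempty X := ⟨x₀⟩
  set U : Set X := (fun z => dist z x₀) ⁻¹' (Metric.cthickening (3 * ε) ((fun c => t * c) '' C)) with hU
  have hUm : MeasurableSet U :=
    (Metric.isClosed_cthickening.preimage (by fun_prop)).measurableSet
  set c : ℝ≥0∞ := ENNReal.ofReal (1 / t) + ENNReal.ofReal (1 / (1 - t)) with hc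
  have hctop : c ≠ ∞ := by simp [hc]
  have key : ∀ η : ℝ≥0∞, 0 < η → η ≠ ∞ → μt univ = 1 ∧ ENNReal.ofReal (ε ^ 2 / 2) * μt Uᶜ ≤ c * η := by
    intro η hη hηt
    obtain ⟨q1, hq1, hq1'⟩ := bg_exists_coupling μ0 μt (ENNReal.ofReal (t ^ 2) * W + η) (by
      rw [hW0]
      exact ENNReal.lt_add_right (ENNReal.mul_ne_top ENNReal.ofReal_ne_top hW) hη.ne')
    obtain ⟨q2, hq2, hq2'⟩ := bg_exists_coupling μt μ1 (ENNReal.ofReal ((1 - t) ^ 2) * W + η) (by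
      rw [hW1]
      exact ENNReal.lt_add_right (ENNReal.mul_ne_top ENNReal.ofReal_ne_top hW) hη.ne')
    have hu1 := bg_prob_of_coupling _ _ _ hq1
    have hu2 := bg_prob_of_coupling _ _ _ hq2
    have hq1u : q1 univ = 1 := by rw [hu1.1]; simp
    have hμt : μt univ = 1 := by rw [← hu1.2, hq1u]
    have hq2u : q2 univ = 1 := by rw [hu2.1, hμt]
    have : IsProbabilityMeasure q1 := ⟨hq1u⟩
    have : IsProbabilityMeasure q2 := ⟨hq2u⟩
    obtain ⟨π, hπ1, hπ2⟩ := bg_glue q1 q2 (by rw [hq1.2, hq2.1])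
    refine ⟨hμt, ?_⟩
    have m1 : Measurable (fun p : X × X × X => (p.2.1, p.1)) := by fun_prop
    have m2 : Measurable (fun p : X × X × X => (p.1, p.2.2)) := by fun_prop
    have mx : Measure.map (fun p : X × X × X => p.2.1) π = μ0 := by
      rw [← hq1.1, ← hπ1, Measure.map_map measurable_fst m1]; rfl
    have mz : Measure.map (fun p : X × X × X => p.1) π = μt := by
      rw [← hq1.2, ← hπ1, Measure.map_map measurable_snd m1]; rfl
    have my : Measure.map (fun p : X × X × X => p.2.2) π = μ1 := by
      rw [← hq2.2, ← hπ2, Measure.map_map measurable_snd m2]; rfl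
    have mxy : IsCoupling (Measure.map (fun p : X × X × X => (p.2.1, p.2.2)) π) μ0 μ1 := by
      constructor
      · rw [← mx, Measure.map_map measurable_fst (by fun_prop)]; rfl
      · rw [← my, Measure.map_map measurable_snd (by fun_prop)]; rfl
    have i1 : ∫⁻ p, edist p.2.1 p.1 ^ 2 ∂π = ∫⁻ p, edist p.1 p.2 ^ 2 ∂q1 := by
      rw [← hπ1, lintegral_map (by fun_prop) m1]
    have i2 : ∫⁻ p, edist p.1 p.2.2 ^ 2 ∂π = ∫⁻ p, edist p.1 p.2 ^ 2 ∂q2 := by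
      rw [← hπ2, lintegral_map (by fun_prop) m2]
    have i3 : W ≤ ∫⁻ p, edist p.2.1 p.2.2 ^ 2 ∂π := by
      have : Wsq μ0 μ1 ≤ ∫⁻ p, edist p.1 p.2 ^ 2 ∂(Measure.map (fun p : X × X × X => (p.2.1, p.2.2)) π) :=
        iInf₂_le (f := fun (q : Measure (X × X)) (_ : IsCoupling q μ0 μ1) =>
          ∫⁻ p, edist p.1 p.2 ^ 2 ∂q) _ mxy
      rw [hW01, lintegral_map (by fun_prop) (by fun_prop)] at this
      exact this
    set D : X × X × X → ℝ≥0∞ := fun p =>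
      ENNReal.ofReal ((dist p.2.1 p.1 - t * dist p.2.1 p.2.2) ^ 2 / 2) with hD
    have hDm : Measurable D := by rw [hD]; fun_prop
    have i4 : ∫⁻ p, D p ∂π + W ≤ c * η + W := by
      calc ∫⁻ p, D p ∂π + W ≤ ∫⁻ p, D p ∂π + ∫⁻ p, edist p.2.1 p.2.2 ^ 2 ∂π := by gcongr
        _ = ∫⁻ p, (D p + edist p.2.1 p.2.2 ^ 2) ∂π := (lintegral_add_left hDm _).symm
        _ ≤ ∫⁻ p, (ENNReal.ofReal (1 / t) * edist p.2.1 p.1 ^ 2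
              + ENNReal.ofReal (1 / (1 - t)) * edist p.1 p.2.2 ^ 2) ∂π :=
            lintegral_mono fun p => bg_pointwise' t ht0 ht1 p.2.1 p.2.2 p.1
        _ = ENNReal.ofReal (1 / t) * ∫⁻ p, edist p.1 p.2 ^ 2 ∂q1
              + ENNReal.ofReal (1 / (1 - t)) * ∫⁻ p, edist p.1 p.2 ^ 2 ∂q2 := by
            rw [lintegral_add_left (by fun_prop), lintegral_const_mul _ (by fun_prop),
              lintegral_const_mul _ (by fun_prop), i1, i2]
        _ ≤ ENNReal.ofReal (1 / t) * (ENNReal.ofReal (t ^ 2) * W + η)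
              + ENNReal.ofReal (1 / (1 - t)) * (ENNReal.ofReal ((1 - t) ^ 2) * W + η) := by
            gcongr
        _ = (ENNReal.ofReal t + ENNReal.ofReal (1 - t)) * W + c * η := by
            have a1 : ENNReal.ofReal (1 / t) * ENNReal.ofReal (t ^ 2) = ENNReal.ofReal t := by
              rw [← ENNReal.ofReal_mul (by positivity)]; congr 1; field_simp
            have a2 : ENNReal.ofReal (1 / (1 - t)) * ENNReal.ofReal ((1 - t) ^ 2)
                = ENNReal.ofReal (1 - t) := by
              rw [← ENNReal.ofReal_mul (by positivity)]; congr 1; field_simp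
            rw [mul_add, mul_add, ← mul_assoc, ← mul_assoc, a1, a2, hc]
            ring
        _ = c * η + W := by
            rw [← ENNReal.ofReal_add ht0.le ht1'.le]
            simp [add_comm]
    have i5 : ∫⁻ p, D p ∂π ≤ c * η := (ENNReal.add_le_add_iff_right hW).1 i4
    have hx : ∀ᵐ p ∂π, dist p.2.1 x₀ < ε := by
      rw [← mx] at h0
      exact ae_of_ae_map (f := fun p : X × X × X => p.2.1) (by fun_prop) h0
    have hy : ∀ᵐ p ∂π, dist p.2.2 x₀ ∈ C := by
      rw [← my] at h1
      exact ae_of_ae_map (f := fun p : X × X × X => p.2.2) (by fun_prop) h1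
    have i6 : μt Uᶜ ≤ π {p | ENNReal.ofReal (ε ^ 2 / 2) ≤ D p} := by
      rw [← mz, Measure.map_apply (by fun_prop) hUm.compl]
      apply measure_mono_ae
      filter_upwards [hx, hy] with p hpx hpy
      intro hpU
      by_contra hcon
      apply hpU
      have hcon' : D p < ENNReal.ofReal (ε ^ 2 / 2) := not_le.1 hcon
      rw [hD] at hcon'
      have h3 := (ENNReal.ofReal_lt_ofReal_iff (by positivity)).1 hcon'
      have h4 : |dist p.2.1 p.1 - t * dist p.2.1 p.2.2| < ε := by
        apply abs_lt_of_sq_lt_sq _ hε.le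
        linarith
      change dist p.1 x₀ ∈ Metric.cthickening _ _
      refine Metric.mem_cthickening_of_dist_le _ (t * dist p.2.2 x₀) _ _ (mem_image_of_mem _ hpy) ?_
      rw [Real.dist_eq]
      have t1 := dist_triangle p.1 p.2.1 x₀
      have t2 := dist_triangle p.2.1 x₀ p.1
      have t3 := dist_triangle p.2.1 x₀ p.2.2
      have t4 := dist_triangle p.2.2 p.2.1 x₀
      rw [dist_comm x₀ p.1] at t2
      rw [dist_comm x₀ p.2.2] at t3
      rw [dist_comm p.1 p.2.1] at t1
      rw [dist_comm p.2.2 p.2.1] at t4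
      have t5 : |dist p.2.1 p.2.2 - dist p.2.2 x₀| ≤ ε := by
        rw [abs_le]; constructor <;> linarith
      have t6 : |t * (dist p.2.1 p.2.2 - dist p.2.2 x₀)| ≤ ε := by
        rw [abs_mul, abs_of_pos ht0]
        nlinarith [abs_nonneg (dist p.2.1 p.2.2 - dist p.2.2 x₀)]
      rw [abs_le] at t6 ⊢
      rw [abs_lt] at h4
      constructor <;> linarith [t6.1, t6.2, h4.1, h4.2]
    calc ENNReal.ofReal (ε ^ 2 / 2) * μt Uᶜ
        ≤ ENNReal.ofReal (ε ^ 2 / 2) * π {p | ENNReal.ofReal (ε ^ 2 / 2) ≤ D p} := by gcongr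
      _ ≤ ∫⁻ p, D p ∂π := mul_meas_ge_le_lintegral₀ hDm.aemeasurable _
      _ ≤ c * η := i5
  refine ⟨(key 1 one_pos (by simp)).1, ?_⟩
  change μt Uᶜ = 0
  have h3 : ENNReal.ofReal (ε ^ 2 / 2) * μt Uᶜ ≤ 0 := by
    have hl : Tendsto (fun η : ℝ≥0∞ => c * η) (𝓝[>] 0) (𝓝 0) := by
      have : Tendsto (fun η : ℝ≥0∞ => c * η) (𝓝 0) (𝓝 (c * 0)) :=
        ENNReal.Tendsto.const_mul tendsto_id (Or.inr hctop)
      rw [mul_zero] at this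
      exact this.mono_left nhdsWithin_le_nhds
    apply ge_of_tendsto hl
    filter_upwards [self_mem_nhdsWithin, nhdsWithin_le_nhds (Iio_mem_nhds (ENNReal.zero_lt_top))]
      with η h1 h2
    exact (key η h1 (ne_of_lt h2)).2
  have h4 : ENNReal.ofReal (ε ^ 2 / 2) ≠ 0 := by
    simp only [ne_eq, ENNReal.ofReal_eq_zero, not_le]; positivity
  have := le_antisymm h3 bot_le
  rcases mul_eq_zero.1 this with h | h
  · exact absurd h h4
  · exact h

lemma bg_Wsq_eq {X : Type*} [MetricSpace X] [MeasurableSpace X] (μ ν : Measure X) :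
    Wsq μ ν = W2 μ ν ^ 2 := by
  unfold W2
  rw [← ENNReal.rpow_natCast, ← ENNReal.rpow_mul]
  norm_num

lemma bg_geod_sq {X : Type*} [MetricSpace X] [MeasurableSpace X] (μ : ℝ → Measure X)
    (h : IsW2Geodesic μ) (s t : ℝ) (hs : s ∈ Icc (0:ℝ) 1) (ht : t ∈ Icc (0:ℝ) 1) :
    Wsq (μ s) (μ t) = ENNReal.ofReal ((s - t) ^ 2) * Wsq (μ 0) (μ 1) := by
  rw [bg_Wsq_eq, h s hs t ht, mul_pow, ← bg_Wsq_eq, ← ENNReal.ofReal_pow (abs_nonneg _), sq_abs]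

lemma bg_memP2 {X : Type*} [MetricSpace X] [MeasurableSpace X] (μ : Measure X)
    (hμ : IsProbabilityMeasure μ) (x₀ : X) (M : ℝ) (h : ∀ᵐ x ∂μ, dist x x₀ ≤ M) : MemP2 μ := by
  refine ⟨hμ, x₀, ?_⟩
  calc ∫⁻ x, edist x x₀ ^ 2 ∂μ ≤ ∫⁻ _, ENNReal.ofReal M ^ 2 ∂μ := by
        apply lintegral_mono_ae
        filter_upwards [h] with x hx
        rw [edist_dist]
        gcongr
    _ < ∞ := by simp

lemma bg_holder {X : Type*} [MeasurableSpace X] (m μ : Measure X) (N : ℝ) (hN : 1 < N)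
    (T : Set X) (hT : MeasurableSet T) (hμ : μ univ = 1) (h : ∀ᵐ z ∂μ, z ∈ T) :
    ∫⁻ x, (μ.rnDeriv m x) ^ (1 - 1/N : ℝ) ∂m ≤ m T ^ (1 / N) := by
  have hN0 : 0 < N := by linarith
  have hp : 0 < 1 - 1 / N := by
    have : 1 / N < 1 := by rw [div_lt_one hN0]; exact hN
    linarith
  have h0 : ∫⁻ x in Tᶜ, μ.rnDeriv m x ∂m = 0 :=
    le_antisymm ((Measure.setLIntegral_rnDeriv_le _).trans (le_of_eq h)) bot_le
  rw [setLIntegral_eq_zero_iff hT.compl (Measure.measurable_rnDeriv _ _)] at h0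
  calc ∫⁻ x, (μ.rnDeriv m x) ^ (1 - 1/N : ℝ) ∂m
      ≤ ∫⁻ x, (μ.rnDeriv m x) ^ (1 - 1/N : ℝ) * (T.indicator 1 x) ^ (1 / N) ∂m := by
        apply lintegral_mono_ae
        filter_upwards [h0] with x hx
        by_cases hxT : x ∈ T
        · simp [hxT]
        · rw [hx hxT, ENNReal.zero_rpow_of_pos hp]; simp
    _ ≤ (∫⁻ x, μ.rnDeriv m x ∂m) ^ (1 - 1/N : ℝ) * (∫⁻ x, T.indicator 1 x ∂m) ^ (1 / N) := by
        apply ENNReal.lintegral_mul_norm_pow_le (Measure.measurable_rnDeriv _ _).aemeasurable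
          ((measurable_one.indicator hT).aemeasurable) hp.le (by positivity) (by ring)
    _ ≤ 1 * m T ^ (1 / N) := by
        gcongr
        · calc (∫⁻ x, μ.rnDeriv m x ∂m) ^ (1 - 1/N : ℝ) ≤ 1 ^ (1 - 1/N : ℝ) := by
                gcongr
                rw [← hμ]
                exact Measure.lintegral_rnDeriv_le
            _ = 1 := by simp
        · rw [lintegral_indicator_one hT]
    _ = _ := one_mul _

lemma bg_BM1 {X : Type*} [MetricSpace X] [CompleteSpace X] [SecondCountableTopology X]
    [MeasurableSpace X] [BorelSpace X] (m : Measure X) [IsLocallyFiniteMeasure m]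
    (hsupp : mmSupp m = Set.univ) (K N : ℝ) (hN : 1 < N) (hCD : CD K N m)
    (x₀ : X) (t : ℝ) (ht0 : 0 < t) (ht1 : t < 1) (ε : ℝ) (hε : 0 < ε)
    (hmε : m (Metric.ball x₀ ε) ≠ ∞) (S : Set X) (hS : MeasurableSet S) (M : ℝ)
    (hSM : ∀ y ∈ S, dist y x₀ ≤ M) (C : Set ℝ) (hSC : ∀ y ∈ S, dist y x₀ ∈ C)
    (w : X → ℝ≥0∞) (hw : Measurable w) (hw0 : ∀ y ∈ S, w y ≠ 0) (hwt : ∀ y ∈ S, w y ≠ ∞)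
    (Z : ℝ≥0∞) (hZ : Z = ∫⁻ y in S, w y ∂m) (hZ0 : Z ≠ 0) (hZt : Z ≠ ∞) (lam : ℝ≥0∞)
    (hlam : ∀ y ∈ S, ∀ θ, |θ - dist y x₀| < ε → lam * w y ^ (1 / N) ≤ tauCoef K N t θ) :
    lam * Z ^ (1 / N) ≤
      m ((fun z => dist z x₀) ⁻¹' (Metric.cthickening (3 * ε) ((fun c => t * c) '' C))) ^ (1 / N) := by
  have hN0 : 0 < N := by linarith
  have hb0 : m (Metric.ball x₀ ε) ≠ 0 := by
    have : x₀ ∈ mmSupp m := by rw [hsupp]; trivial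
    exact (this _ (Metric.ball_mem_nhds x₀ hε)).ne'
  set μ0 : Measure X := ProbabilityTheory.cond m (Metric.ball x₀ ε) with hμ0
  have hμ0p : IsProbabilityMeasure μ0 := ProbabilityTheory.cond_isProbabilityMeasure_of_finite hb0 hmε
  have hμ0ac : μ0 ≪ m := ProbabilityTheory.cond_absolutelyContinuous
  have hμ0b : ∀ᵐ x ∂μ0, dist x x₀ < ε := ProbabilityTheory.ae_cond_mem measurableSet_ball
  set ρ : X → ℝ≥0∞ := S.indicator (fun y => w y / Z) with hρ
  have hρm : Measurable ρ := (hw.div_const Z).indicator hS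
  set μ1 : Measure X := m.withDensity ρ with hμ1
  have hμ1u : μ1 univ = 1 := by
    rw [hμ1, withDensity_apply _ MeasurableSet.univ, Measure.restrict_univ, hρ,
      lintegral_indicator hS]
    simp_rw [div_eq_mul_inv]
    rw [lintegral_mul_const _ hw, ← hZ, ENNReal.mul_inv_cancel hZ0 hZt]
  have hμ1p : IsProbabilityMeasure μ1 := ⟨hμ1u⟩
  have hμ1ac : μ1 ≪ m := withDensity_absolutelyContinuous _ _
  have hμ1S : ∀ᵐ x ∂μ1, x ∈ S := by
    change μ1 Sᶜ = 0
    rw [hμ1, withDensity_apply _ hS.compl, hρ, setLIntegral_indicator hS]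
    simp
  have hrn : ∀ᵐ x ∂μ1, μ1.rnDeriv m x = ρ x := hμ1ac.ae_le (Measure.rnDeriv_withDensity m hρm)
  obtain ⟨μ, q, e0, e1, hgeo, -, hq, hqopt, hineq⟩ := hCD μ0 μ1
    (bg_memP2 μ0 hμ0p x₀ ε (hμ0b.mono fun x hx => hx.le))
    (bg_memP2 μ1 hμ1p x₀ M (hμ1S.mono fun x hx => hSM x hx)) hμ0ac hμ1ac
  have hqu : q univ = 1 := by rw [(bg_prob_of_coupling _ _ _ hq).2, hμ1u]
  have hq0 : ∀ᵐ p ∂q, dist p.1 x₀ < ε := by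
    rw [← hq.1] at hμ0b
    exact ae_of_ae_map measurable_fst.aemeasurable hμ0b
  have hq1 : ∀ᵐ p ∂q, p.2 ∈ S ∧ μ1.rnDeriv m p.2 = ρ p.2 := by
    have : ∀ᵐ x ∂(Measure.map Prod.snd q), x ∈ S ∧ μ1.rnDeriv m x = ρ x := by
      rw [hq.2]; exact hμ1S.and hrn
    exact ae_of_ae_map measurable_snd.aemeasurable this
  have hWfin : Wsq μ0 μ1 ≠ ∞ := by
    rw [← hqopt]
    apply ne_of_lt
    calc ∫⁻ p, edist p.1 p.2 ^ 2 ∂q ≤ ∫⁻ _, ENNReal.ofReal (ε + M) ^ 2 ∂q := by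
          apply lintegral_mono_ae
          filter_upwards [hq0, hq1] with p h0 h1
          rw [edist_dist]
          gcongr
          have := hSM _ h1.1
          have := dist_triangle_right p.1 p.2 x₀
          linarith
      _ < ∞ := by simp [hqu]
  have htI : t ∈ Icc (0:ℝ) 1 := ⟨ht0.le, ht1.le⟩
  have hsup := bg_support x₀ μ0 (μ t) μ1 t ht0 ht1 (Wsq μ0 μ1) hWfin rfl
    (by have := bg_geod_sq μ hgeo 0 t (by simp) htI
        rw [e0, e1] at this
        rw [this]; congr 2; ring)
    (by have := bg_geod_sq μ hgeo t 1 htI (by simp)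
        rw [e0, e1] at this
        rw [this]; congr 2; ring)
    ε hε C hμ0b (hμ1S.mono fun x hx => hSC x hx)
  have hTm : MeasurableSet ((fun z => dist z x₀) ⁻¹'
      (Metric.cthickening (3 * ε) ((fun c => t * c) '' C))) :=
    (Metric.isClosed_cthickening.preimage (by fun_prop)).measurableSet
  refine le_trans ?_ (bg_holder m (μ t) N hN _ hTm hsup.1 hsup.2)
  refine le_trans ?_ (hineq t htI)
  calc lam * Z ^ (1 / N) = ∫⁻ _, lam * Z ^ (1 / N) ∂q := by simp [hqu]
    _ ≤ _ := by
      apply lintegral_mono_ae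
      filter_upwards [hq0, hq1] with p h0 h1
      refine le_trans ?_ le_add_self
      obtain ⟨hpS, hpρ⟩ := h1
      rw [hpρ, hρ, indicator_of_mem hpS]
      have hd : |dist p.1 p.2 - dist p.2 x₀| < ε := by
        rw [abs_lt]
        have a1 := dist_triangle_right p.1 p.2 x₀
        have a2 := dist_triangle_left p.2 x₀ p.1
        constructor <;> linarith
      have := hlam p.2 hpS _ hd
      have hwi0 : w p.2 ^ (1 / N) ≠ 0 := by
        simp [ENNReal.rpow_eq_zero_iff, hw0 _ hpS, hwt _ hpS]
      have hwit : w p.2 ^ (1 / N) ≠ ∞ := by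
        simp [ENNReal.rpow_eq_top_iff, hw0 _ hpS, hwt _ hpS]
      calc lam * Z ^ (1 / N)
          = (lam * w p.2 ^ (1 / N)) * (w p.2 / Z) ^ (-(1 / N)) := by
            rw [ENNReal.rpow_neg, ENNReal.div_rpow_of_nonneg _ _ (by positivity),
              ENNReal.inv_div (Or.inr hwit) (Or.inr hwi0), mul_assoc,
              ENNReal.mul_div_cancel hwi0 hwit]
        _ ≤ _ := by gcongr

/-- The `N`-th power of the distortion coefficient, in terms of a model function `s`. -/
def bgphi (s : ℝ → ℝ) (N t θ : ℝ) : ℝ := t * (s (t * θ) / s θ) ^ (N - 1)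

lemma bgphi_pos (s : ℝ → ℝ) (N R : ℝ) (hs : ∀ θ ∈ Ioo 0 R, 0 < s θ) (t : ℝ) (ht0 : 0 < t)
    (ht1 : t < 1) (θ : ℝ) (hθ : θ ∈ Ioo 0 R) : 0 < bgphi s N t θ := by
  have h1 := hs θ hθ
  have h2 : 0 < s (t * θ) := hs _ ⟨mul_pos ht0 hθ.1, by nlinarith [hθ.1, hθ.2]⟩
  unfold bgphi
  positivity

lemma bgphi_cont (s : ℝ → ℝ) (hsc : Continuous s) (N R : ℝ) (hs : ∀ θ ∈ Ioo 0 R, 0 < s θ)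
    (t : ℝ) (ht0 : 0 < t) (ht1 : t < 1) (θ : ℝ) (hθ : θ ∈ Ioo 0 R) :
    ContinuousAt (bgphi s N t) θ := by
  have h1 := hs θ hθ
  have h2 : 0 < s (t * θ) := hs _ ⟨mul_pos ht0 hθ.1, by nlinarith [hθ.1, hθ.2]⟩
  unfold bgphi
  apply ContinuousAt.mul continuousAt_const
  apply ContinuousAt.rpow_const
  · exact ContinuousAt.div (by fun_prop) (by fun_prop) h1.ne'
  · left; positivity

lemma bgphi_meas (s : ℝ → ℝ) (hsc : Continuous s) (N : ℝ) : Measurable (Function.uncurry (bgphi s N)) := by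
  unfold bgphi Function.uncurry
  have := hsc.measurable
  fun_prop

lemma bg_uniform (s : ℝ → ℝ) (hsc : Continuous s) (N R : ℝ) (hs : ∀ θ ∈ Ioo 0 R, 0 < s θ)
    (t : ℝ) (ht0 : 0 < t) (ht1 : t < 1) (r R' : ℝ) (hr : 0 < r) (hR' : R' < R) (δ : ℝ) (hδ : 0 < δ) :
    ∃ ε0 > 0, ∀ a ∈ Icc r R', ∀ θ, |θ - a| < ε0 → θ ∈ Ioo 0 R ∧
      (1 - δ) * bgphi s N t a ^ (1 / N) ≤ bgphi s N t θ ^ (1 / N) := by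
  have hsub : ∀ a ∈ Icc r R', a ∈ Ioo 0 R := fun a ha => ⟨by linarith [ha.1], by linarith [ha.2]⟩
  have hc : ∀ a ∈ Icc r R', ContinuousAt (fun θ => bgphi s N t θ ^ (1 / N)) a := fun a ha =>
    (bgphi_cont s hsc N R hs t ht0 ht1 a (hsub a ha)).rpow_const
      (Or.inl (bgphi_pos s N R hs t ht0 ht1 a (hsub a ha)).ne')
  obtain ⟨c, hc0, hcl⟩ := isCompact_Icc.exists_forall_le' (s := Icc r R')
    (f := fun θ => bgphi s N t θ ^ (1 / N)) (a := 0)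
    (fun a ha => (hc a ha).continuousWithinAt)
    (fun a ha => Real.rpow_pos_of_pos (bgphi_pos s N R hs t ht0 ht1 a (hsub a ha)) _)
  have hu := isCompact_Icc.uniformContinuousAt_of_continuousAt _ hc
    (Metric.dist_mem_uniformity (mul_pos hδ hc0))
  obtain ⟨e, he0, he⟩ := Metric.mem_uniformity_dist.1 hu
  refine ⟨min e (min r (R - R')), lt_min he0 (lt_min hr (by linarith)), ?_⟩
  intro a ha θ hθ
  have h1 := lt_min_iff.1 hθ
  have h2 := lt_min_iff.1 h1.2
  have h3 : dist a θ < e := by rw [dist_comm, Real.dist_eq]; exact h1.1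
  have h4 := he h3 ha
  have h5 := hcl a ha
  simp only [mem_ofPred_eq, Real.dist_eq] at h4
  rw [abs_lt] at h4
  have h6 := abs_lt.1 h2.1
  have h7 := abs_lt.1 h2.2
  refine ⟨⟨by linarith [ha.1], by linarith [ha.2]⟩, ?_⟩
  nlinarith [mul_le_mul_of_nonneg_left h5 hδ.le]

lemma bg_BM {X : Type*} [MetricSpace X] [CompleteSpace X] [SecondCountableTopology X]
    [MeasurableSpace X] [BorelSpace X] (m : Measure X) [IsLocallyFiniteMeasure m]
    (hsupp : mmSupp m = Set.univ) (K N : ℝ) (hN : 1 < N) (hCD : CD K N m)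
    (s : ℝ → ℝ) (hsc : Continuous s) (R : ℝ) (hs : ∀ θ ∈ Ioo 0 R, 0 < s θ)
    (htau : ∀ t ∈ Ioo (0:ℝ) 1, ∀ θ ∈ Ioo 0 R,
      tauCoef K N t θ = ENNReal.ofReal (bgphi s N t θ ^ (1 / N)))
    (x₀ : X) (t : ℝ) (ht0 : 0 < t) (ht1 : t < 1) (r R' : ℝ) (hr : 0 < r) (hR' : R' < R)
    (hmr : m (Metric.ball x₀ r) ≠ ∞)
    (S : Set X) (hS : MeasurableSet S) (hmS : m S ≠ ∞)
    (hSr : ∀ y ∈ S, dist y x₀ ∈ Icc r R') (C : Set ℝ) (hC : IsCompact C)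
    (hCr : ∀ c ∈ C, t * c < r) (hSC : ∀ y ∈ S, dist y x₀ ∈ C) :
    ∫⁻ y in S, ENNReal.ofReal (bgphi s N t (dist y x₀)) ∂m ≤
      m ((fun z => dist z x₀) ⁻¹' ((fun c => t * c) '' C)) := by
  have hN0 : 0 < N := by linarith
  have hsub : ∀ a ∈ Icc r R', a ∈ Ioo 0 R := fun a ha => ⟨by linarith [ha.1], by linarith [ha.2]⟩
  have hfm : Measurable (fun z : X => dist z x₀) := by fun_prop
  have hphm : Measurable (bgphi s N t) := (bgphi_meas s hsc N).comp measurable_prodMk_left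
  set w : X → ℝ≥0∞ := fun y => ENNReal.ofReal (bgphi s N t (dist y x₀)) with hw
  have hwm : Measurable w := (hphm.comp hfm).ennreal_ofReal
  set Z := ∫⁻ y in S, w y ∂m with hZ
  by_cases hZ0 : Z = 0
  · rw [hZ0]; exact bot_le
  have hZt : Z ≠ ∞ := by
    obtain ⟨B, hB⟩ := isCompact_Icc.exists_bound_of_continuousOn (s := Icc r R') (f := bgphi s N t)
      (fun a ha => (bgphi_cont s hsc N R hs t ht0 ht1 a (hsub a ha)).continuousWithinAt)
    apply ne_of_lt
    calc Z ≤ ∫⁻ _ in S, ENNReal.ofReal B ∂m := by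
          apply setLIntegral_mono measurable_const
          intro y hy
          exact ENNReal.ofReal_le_ofReal ((le_abs_self _).trans (hB _ (hSr y hy)))
      _ < ∞ := by
          rw [setLIntegral_const]
          exact ENNReal.mul_lt_top ENNReal.ofReal_lt_top hmS.lt_top
  set tC := (fun c => t * c) '' C with htC
  have htCc : IsCompact tC := hC.image (by fun_prop)
  have hlim : Tendsto (fun ε => m ((fun z => dist z x₀) ⁻¹' (Metric.cthickening (3 * ε) tC)))
      (𝓝[>] 0) (𝓝 (m ((fun z => dist z x₀) ⁻¹' tC))) := by
    have h1 : ∃ e > 0, (m.map (fun z => dist z x₀)) (Metric.cthickening e tC) ≠ ∞ := by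
      obtain ⟨e, he, hsube⟩ := htCc.exists_cthickening_subset_open (isOpen_Iio (a := r))
        (by rintro _ ⟨c, hc, rfl⟩; exact hCr c hc)
      refine ⟨e, he, ?_⟩
      rw [Measure.map_apply hfm Metric.isClosed_cthickening.measurableSet]
      exact ne_top_of_le_ne_top hmr (measure_mono fun z hz => hsube hz)
    have h2 := tendsto_measure_cthickening h1
    rw [htCc.isClosed.closure_eq, Measure.map_apply hfm htCc.isClosed.measurableSet] at h2
    have h3 : Tendsto (fun ε : ℝ => 3 * ε) (𝓝[>] 0) (𝓝 0) := by
      have : Tendsto (fun ε : ℝ => 3 * ε) (𝓝 0) (𝓝 (3 * 0)) := by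
        apply Continuous.tendsto; fun_prop
      rw [mul_zero] at this
      exact this.mono_left nhdsWithin_le_nhds
    refine (h2.comp h3).congr fun ε => ?_
    simp only [Function.comp]
    rw [Measure.map_apply hfm Metric.isClosed_cthickening.measurableSet]
  have hfin : ∀ᶠ ε in 𝓝[>] (0:ℝ), m (Metric.ball x₀ ε) ≠ ∞ := by
    filter_upwards [nhdsWithin_le_nhds (Iio_mem_nhds hr)] with ε hε
    exact ne_top_of_le_ne_top hmr (measure_mono (Metric.ball_subset_ball (le_of_lt hε)))
  have hδ : ∀ δ : ℝ, 0 < δ → δ < 1 → ENNReal.ofReal (1 - δ) * Z ^ (1 / N) ≤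
      m ((fun z => dist z x₀) ⁻¹' tC) ^ (1 / N) := by
    intro δ hδ0 hδ1
    obtain ⟨ε0, hε0, hun⟩ := bg_uniform s hsc N R hs t ht0 ht1 r R' hr hR' δ hδ0
    apply ge_of_tendsto (hlim.ennrpow_const (1 / N))
    filter_upwards [self_mem_nhdsWithin, nhdsWithin_le_nhds (Iio_mem_nhds hε0), hfin] with ε h1 h2 h3
    apply bg_BM1 m hsupp K N hN hCD x₀ t ht0 ht1 ε h1 h3 S hS R' (fun y hy => (hSr y hy).2) C hSC
      w hwm _ _ Z hZ hZ0 hZt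
    · intro y hy θ hθ
      obtain ⟨h4, h5⟩ := hun _ (hSr y hy) θ (lt_trans hθ h2)
      have hp := bgphi_pos s N R hs t ht0 ht1 _ (hsub _ (hSr y hy))
      rw [htau t ⟨ht0, ht1⟩ θ h4, hw]
      simp only
      rw [ENNReal.ofReal_rpow_of_pos hp, ← ENNReal.ofReal_mul (by linarith)]
      exact ENNReal.ofReal_le_ofReal h5
    · intro y hy
      have hp := bgphi_pos s N R hs t ht0 ht1 _ (hsub _ (hSr y hy))
      simp only [hw, ne_eq, ENNReal.ofReal_eq_zero, not_le]
      exact hp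
    · intro y hy; exact ENNReal.ofReal_ne_top
  rw [← ENNReal.rpow_le_rpow_iff (z := 1 / N) (by positivity)]
  have hl : Tendsto (fun δ : ℝ => ENNReal.ofReal (1 - δ) * Z ^ (1 / N)) (𝓝[>] 0)
      (𝓝 (ENNReal.ofReal (1 - 0) * Z ^ (1 / N))) := by
    apply ENNReal.Tendsto.mul_const
    · apply Tendsto.mono_left _ nhdsWithin_le_nhds
      apply Continuous.tendsto
      exact ENNReal.continuous_ofReal.comp (by fun_prop)
    · left; simp
  simp only [sub_zero, ENNReal.ofReal_one, one_mul] at hl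
  apply le_of_tendsto hl
  filter_upwards [self_mem_nhdsWithin, nhdsWithin_le_nhds (Iio_mem_nhds one_pos)] with δ h1 h2
  exact hδ δ h1 h2

lemma bg_fun {X : Type*} [MetricSpace X] [CompleteSpace X] [SecondCountableTopology X]
    [MeasurableSpace X] [BorelSpace X] (m : Measure X) [IsLocallyFiniteMeasure m]
    (hsupp : mmSupp m = Set.univ) (K N : ℝ) (hN : 1 < N) (hCD : CD K N m)
    (s : ℝ → ℝ) (hsc : Continuous s) (R : ℝ) (hs : ∀ θ ∈ Ioo 0 R, 0 < s θ)
    (htau : ∀ t ∈ Ioo (0:ℝ) 1, ∀ θ ∈ Ioo 0 R,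
      tauCoef K N t θ = ENNReal.ofReal (bgphi s N t θ ^ (1 / N)))
    (x₀ : X) (t : ℝ) (ht0 : 0 < t) (ht1 : t < 1) (r R' : ℝ) (hr : 0 < r) (hR' : R' < R)
    (hmr : m (Metric.ball x₀ r) ≠ ∞)
    (S : Set X) (hS : MeasurableSet S) (hmS : m S ≠ ∞)
    (hSr : ∀ y ∈ S, dist y x₀ ∈ Icc r R') (g : ℝ → ℝ≥0∞) (hg : Measurable g)
    (hg0 : ∀ θ, r ≤ t * θ → g θ = 0) :
    ∫⁻ y in S, ENNReal.ofReal (bgphi s N t (dist y x₀)) * g (dist y x₀) ∂m ≤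
      ∫⁻ x, g (dist x x₀ / t) ∂m := by
  have hsub : ∀ a ∈ Icc r R', a ∈ Ioo 0 R := fun a ha => ⟨by linarith [ha.1], by linarith [ha.2]⟩
  have hfm : Measurable (fun z : X => dist z x₀) := by fun_prop
  have hphm : Measurable (bgphi s N t) := (bgphi_meas s hsc N).comp measurable_prodMk_left
  set w : X → ℝ≥0∞ := fun y => ENNReal.ofReal (bgphi s N t (dist y x₀)) with hw
  have hwm : Measurable w := (hphm.comp hfm).ennreal_ofReal
  set V : Set ℝ := {θ | t * θ < r} with hV
  have hVm : MeasurableSet V := measurableSet_lt (by fun_prop) (by fun_prop)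
  set S' : Set X := S ∩ (fun z => dist z x₀) ⁻¹' V with hS'
  have hS'm : MeasurableSet S' := hS.inter (hfm hVm)
  set ν1 : Measure ℝ := ((m.restrict S').withDensity w).map (fun z => dist z x₀) with hν1
  set ν2 : Measure ℝ := m.map (fun z => dist z x₀ / t) with hν2
  have hf2m : Measurable (fun z : X => dist z x₀ / t) := by fun_prop
  have hν1a : ∀ E, MeasurableSet E → ν1 E = ∫⁻ y in S' ∩ (fun z => dist z x₀) ⁻¹' E, w y ∂m := by
    intro E hE
    rw [hν1, Measure.map_apply hfm hE, withDensity_apply _ (hfm hE),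
      Measure.restrict_restrict (hfm hE), inter_comm]
  have hν1V : ν1 Vᶜ = 0 := by
    rw [hν1a _ hVm.compl]
    have : S' ∩ (fun z => dist z x₀) ⁻¹' Vᶜ = ∅ := by
      ext z; simp only [hS', mem_inter_iff, mem_preimage, mem_compl_iff, mem_empty_iff_false]; tauto
    rw [this]; simp
  have hfinite : IsFiniteMeasure ν1 := by
    obtain ⟨B, hB⟩ := isCompact_Icc.exists_bound_of_continuousOn (s := Icc r R') (f := bgphi s N t)
      (fun a ha => (bgphi_cont s hsc N R hs t ht0 ht1 a (hsub a ha)).continuousWithinAt)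
    constructor
    rw [hν1a _ MeasurableSet.univ, preimage_univ, inter_univ]
    calc ∫⁻ y in S', w y ∂m ≤ ∫⁻ _ in S', ENNReal.ofReal B ∂m := by
          apply setLIntegral_mono measurable_const
          intro y hy
          exact ENNReal.ofReal_le_ofReal ((le_abs_self _).trans (hB _ (hSr y hy.1)))
      _ < ∞ := by
          rw [setLIntegral_const]
          exact ENNReal.mul_lt_top ENNReal.ofReal_lt_top
            (lt_of_le_of_lt (measure_mono inter_subset_left) hmS.lt_top)
  have hle : ν1 ≤ ν2 := by
    rw [Measure.le_iff]
    intro E hE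
    have e1 : ν1 E = ν1 (E ∩ V) := by
      rw [measure_inter_conull hν1V]
    rw [e1, (hE.inter hVm).measure_eq_iSup_isCompact ν1]
    refine iSup_le fun C => iSup_le fun hCE => iSup_le fun hC => ?_
    rw [hν1a _ hC.isClosed.measurableSet]
    have hCm := hC.isClosed.measurableSet
    refine (bg_BM m hsupp K N hN hCD s hsc R hs htau x₀ t ht0 ht1 r R' hr hR' hmr
      (S' ∩ (fun z => dist z x₀) ⁻¹' C) (hS'm.inter (hfm hCm)) ?_ ?_ C hC ?_ ?_).trans ?_
    · exact ne_top_of_le_ne_top hmS (measure_mono fun z hz => hz.1.1)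
    · exact fun y hy => hSr y hy.1.1
    · exact fun c hc => (hCE hc).2
    · exact fun y hy => hy.2
    · rw [hν2, Measure.map_apply hf2m hE]
      apply measure_mono
      rintro z ⟨c, hc, hcz⟩
      change dist z x₀ / t ∈ E
      simp only at hcz
      rw [← hcz, mul_div_cancel_left₀ _ ht0.ne']
      exact (hCE hc).1
  calc ∫⁻ y in S, w y * g (dist y x₀) ∂m
      ≤ ∫⁻ y in S', w y * g (dist y x₀) ∂m := by
        rw [hS', inter_comm, ← Measure.restrict_restrict (hfm hVm), ← lintegral_indicator (hfm hVm)]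
        apply lintegral_mono
        intro y
        by_cases hy : dist y x₀ ∈ V
        · rw [indicator_of_mem (show y ∈ (fun z => dist z x₀) ⁻¹' V from hy)]
        · simp only
          rw [hg0 _ (not_lt.1 hy)]; simp
    _ = ∫⁻ θ, g θ ∂ν1 := by
        rw [hν1, lintegral_map hg hfm, lintegral_withDensity_eq_lintegral_mul _ hwm
          (show Measurable (fun z : X => g (dist z x₀)) from hg.comp hfm)]
        rfl
    _ ≤ ∫⁻ θ, g θ ∂ν2 := lintegral_mono' hle le_rfl
    _ = _ := by rw [hν2, lintegral_map hg hf2m]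

lemma bg_cov1 (σ : ℝ → ℝ≥0∞) (r θ : ℝ) (hr : 0 < r) (hθ : r ≤ θ) :
    ∫⁻ u in Ioo 0 r, σ u =
      ∫⁻ t in Ioo (0:ℝ) 1, {t | t * θ < r}.indicator (fun t => ENNReal.ofReal θ * σ (t * θ)) t := by
  have hθ0 : 0 < θ := by linarith
  have hm : MeasurableSet {t : ℝ | t * θ < r} := measurableSet_lt (by fun_prop) (by fun_prop)
  have hset : {t : ℝ | t * θ < r} ∩ Ioo 0 1 = Ioo 0 (r / θ) := by
    ext t
    simp only [mem_inter_iff, mem_ofPred_eq, mem_Ioo, lt_div_iff₀ hθ0]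
    constructor
    · rintro ⟨h1, h2, h3⟩; exact ⟨h2, h1⟩
    · rintro ⟨h1, h2⟩; exact ⟨h2, h1, by by_contra h; nlinarith⟩
  have him : (fun t => t * θ) '' Ioo 0 (r / θ) = Ioo 0 r := by
    ext u
    constructor
    · rintro ⟨t, ht, rfl⟩
      exact ⟨mul_pos ht.1 hθ0, (lt_div_iff₀ hθ0).1 ht.2⟩
    · intro hu
      exact ⟨u / θ, ⟨div_pos hu.1 hθ0, div_lt_div_of_pos_right hu.2 hθ0⟩, div_mul_cancel₀ _ hθ0.ne'⟩
  rw [lintegral_indicator hm, Measure.restrict_restrict hm, hset, ← him,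
    lintegral_image_eq_lintegral_abs_deriv_mul measurableSet_Ioo
      (f := fun t => t * θ) (f' := fun _ => θ)]
  · simp only [abs_of_pos hθ0]
  · intro x _
    simpa using ((hasDerivAt_id x).mul_const θ).hasDerivWithinAt
  · intro a _ b _ h
    exact mul_right_cancel₀ hθ0.ne' h

lemma bg_cov2 (σ : ℝ → ℝ≥0∞) (r R x : ℝ) (hr : 0 < r) (hrR : r < R) (hx : 0 ≤ x) (hxr : x < r) :
    ∫⁻ t in Ioo (0:ℝ) 1, {t | r ≤ x / t ∧ x / t < R}.indicator
        (fun t => ENNReal.ofReal (x / t) * σ (x / t) / ENNReal.ofReal t) t ≤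
      ∫⁻ u in Ico r R, σ u := by
  have hm : MeasurableSet {t : ℝ | r ≤ x / t ∧ x / t < R} :=
    (show Measurable (fun t : ℝ => x / t) by fun_prop) measurableSet_Ico
  rw [lintegral_indicator hm, Measure.restrict_restrict hm]
  rcases hx.eq_or_lt with rfl | hx
  · have : {t : ℝ | r ≤ 0 / t ∧ 0 / t < R} ∩ Ioo 0 1 = ∅ := by
      ext t; simp [hr]
    rw [this]; simp
  set A := {t : ℝ | r ≤ x / t ∧ x / t < R} ∩ Ioo 0 1 with hA
  have hAm : MeasurableSet A := hm.inter measurableSet_Ioo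
  have hsub : (fun t => x / t) '' A ⊆ Ico r R := by
    rintro _ ⟨t, ht, rfl⟩; exact ht.1
  refine le_trans (le_of_eq ?_) (lintegral_mono_set hsub)
  rw [lintegral_image_eq_lintegral_abs_deriv_mul hAm (f := fun t => x / t)
    (f' := fun t => x * (-(t ^ 2)⁻¹))]
  · apply setLIntegral_congr_fun hAm
    intro t ht
    have ht0 : 0 < t := ht.2.1
    simp only
    rw [mul_neg, abs_neg, abs_of_pos (by positivity), ENNReal.mul_div_right_comm,
      ← ENNReal.ofReal_div_of_pos ht0]
    congr 2
    field_simp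
  · intro t ht
    have ht0 : 0 < t := ht.2.1
    simpa [div_eq_mul_inv] using ((hasDerivAt_inv ht0.ne').const_mul x).hasDerivWithinAt
  · intro a ha b hb h
    have ha0 : 0 < a := ha.2.1
    have hb0 : 0 < b := hb.2.1
    simp only at h
    rw [div_eq_div_iff ha0.ne' hb0.ne'] at h
    exact (mul_left_cancel₀ hx.ne' h).symm

lemma bg_core {X : Type*} [MetricSpace X] [CompleteSpace X] [SecondCountableTopology X]
    [MeasurableSpace X] [BorelSpace X] (m : Measure X) [IsLocallyFiniteMeasure m]
    (hsupp : mmSupp m = Set.univ) (K N : ℝ) (hN : 1 < N) (hCD : CD K N m)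
    (s : ℝ → ℝ) (hsc : Continuous s) (R : ℝ) (hs : ∀ θ ∈ Ioo 0 R, 0 < s θ)
    (htau : ∀ t ∈ Ioo (0:ℝ) 1, ∀ θ ∈ Ioo 0 R,
      tauCoef K N t θ = ENNReal.ofReal (bgphi s N t θ ^ (1 / N)))
    (x₀ : X) (r R' : ℝ) (hr : 0 < r) (hrR : r < R) (hR' : R' < R)
    (hmr : m (Metric.ball x₀ r) ≠ ∞)
    (S : Set X) (hS : MeasurableSet S) (hmS : m S ≠ ∞)
    (hSr : ∀ y ∈ S, dist y x₀ ∈ Icc r R') :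
    m S * ∫⁻ u in Ioo 0 r, ENNReal.ofReal (s u ^ (N - 1)) ≤
      m (Metric.ball x₀ r) * ∫⁻ u in Ico r R, ENNReal.ofReal (s u ^ (N - 1)) := by
  set σ : ℝ → ℝ≥0∞ := fun u => ENNReal.ofReal (s u ^ (N - 1)) with hσ
  have hσm : Measurable σ := by
    have := hsc.measurable
    rw [hσ]; fun_prop
  have hsub : ∀ a ∈ Icc r R', a ∈ Ioo 0 R := fun a ha => ⟨by linarith [ha.1], by linarith [ha.2]⟩
  set F : X → ℝ → ℝ≥0∞ := fun y t => {t | t * dist y x₀ < r}.indicator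
    (fun t => ENNReal.ofReal (dist y x₀) * σ (t * dist y x₀)) t with hF
  set G : X → ℝ → ℝ≥0∞ := fun x t => {t | r ≤ dist x x₀ / t ∧ dist x x₀ / t < R}.indicator
    (fun t => ENNReal.ofReal (dist x x₀ / t) * σ (dist x x₀ / t) / ENNReal.ofReal t) t with hG
  have hFm : Measurable (Function.uncurry F) := by
    have : Function.uncurry F = {p : X × ℝ | p.2 * dist p.1 x₀ < r}.indicator
      (fun p => ENNReal.ofReal (dist p.1 x₀) * σ (p.2 * dist p.1 x₀)) := by
      ext p; rfl
    rw [this]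
    exact Measurable.indicator (by fun_prop) (measurableSet_lt (by fun_prop) (by fun_prop))
  have hGm : Measurable (Function.uncurry G) := by
    have : Function.uncurry G = {p : X × ℝ | r ≤ dist p.1 x₀ / p.2 ∧ dist p.1 x₀ / p.2 < R}.indicator
      (fun p => ENNReal.ofReal (dist p.1 x₀ / p.2) * σ (dist p.1 x₀ / p.2) / ENNReal.ofReal p.2) := by
      ext p; rfl
    rw [this]
    exact Measurable.indicator (by fun_prop)
      ((show Measurable (fun p : X × ℝ => dist p.1 x₀ / p.2) by fun_prop) measurableSet_Ico)
  calc m S * ∫⁻ u in Ioo 0 r, σ u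
      = ∫⁻ y in S, (∫⁻ u in Ioo 0 r, σ u) ∂m := by rw [setLIntegral_const, mul_comm]
    _ = ∫⁻ y in S, (∫⁻ t in Ioo (0:ℝ) 1, F y t) ∂m := by
        apply setLIntegral_congr_fun hS
        intro y hy
        exact bg_cov1 σ r _ hr (hSr y hy).1
    _ = ∫⁻ t in Ioo (0:ℝ) 1, ∫⁻ y in S, F y t ∂m :=
        lintegral_lintegral_swap hFm.aemeasurable
    _ ≤ ∫⁻ t in Ioo (0:ℝ) 1, ∫⁻ x in Metric.ball x₀ r, G x t ∂m := by
        apply setLIntegral_mono' measurableSet_Ioo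
        intro t ht
        set g : ℝ → ℝ≥0∞ := ({θ | t * θ < r} ∩ Ico r R).indicator
          (fun θ => ENNReal.ofReal θ * σ θ / ENNReal.ofReal t) with hg
        have hgset : MeasurableSet ({θ : ℝ | t * θ < r} ∩ Ico r R) :=
          (measurableSet_lt (by fun_prop) (by fun_prop)).inter measurableSet_Ico
        have hgm : Measurable g := Measurable.indicator (by fun_prop) hgset
        have := bg_fun m hsupp K N hN hCD s hsc R hs htau x₀ t ht.1 ht.2 r R' hr hR' hmr S hS hmS hSr
          g hgm (by
            intro θ hθ
            rw [hg, indicator_of_notMem]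
            rintro ⟨h, -⟩
            exact absurd h (not_lt.2 hθ))
        refine le_trans (le_of_eq ?_) (this.trans (le_of_eq ?_))
        · apply setLIntegral_congr_fun hS
          intro y hy
          have hyR := hSr y hy
          have hy0 := hsub _ hyR
          simp only [hF, hg]
          by_cases hlt : t * dist y x₀ < r
          · have p1 := hs _ hy0
            have p2 : 0 < s (t * dist y x₀) :=
              hs _ ⟨mul_pos ht.1 hy0.1, by nlinarith [hy0.1, hy0.2, ht.2]⟩
            rw [indicator_of_mem (show t ∈ {t | t * dist y x₀ < r} from hlt),
              indicator_of_mem (show dist y x₀ ∈ ({θ | t * θ < r} ∩ Ico r R) from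
                ⟨hlt, hyR.1, hy0.2⟩)]
            have ht0 := ht.1
            have hd := hy0.1
            simp only [hσ]
            rw [← ENNReal.ofReal_mul hd.le, ← ENNReal.ofReal_mul hd.le,
              ← ENNReal.ofReal_div_of_pos ht0, ← ENNReal.ofReal_mul
                (bgphi_pos s N R hs t ht.1 ht.2 _ hy0).le]
            congr 1
            unfold bgphi
            rw [Real.div_rpow p2.le p1.le]
            have p3 := Real.rpow_pos_of_pos p1 (N - 1)
            field_simp
          · rw [indicator_of_notMem (show t ∉ {t | t * dist y x₀ < r} from hlt),
              indicator_of_notMem (fun h => hlt h.1), mul_zero]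
        · rw [← lintegral_indicator measurableSet_ball]
          apply lintegral_congr
          intro x
          have e : t * (dist x x₀ / t) = dist x x₀ := mul_div_cancel₀ _ ht.1.ne'
          simp only [hG, hg, indicator, mem_ofPred_eq, mem_inter_iff, mem_Ico, Metric.mem_ball, e]
          by_cases h1 : dist x x₀ < r <;> simp [h1]
    _ = ∫⁻ x in Metric.ball x₀ r, (∫⁻ t in Ioo (0:ℝ) 1, G x t) ∂m :=
        (lintegral_lintegral_swap hGm.aemeasurable).symm
    _ ≤ ∫⁻ x in Metric.ball x₀ r, (∫⁻ u in Ico r R, σ u) ∂m := by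
        apply setLIntegral_mono' measurableSet_ball
        intro x hx
        exact bg_cov2 σ r R _ hr hrR dist_nonneg hx
    _ = m (Metric.ball x₀ r) * ∫⁻ u in Ico r R, σ u := by rw [setLIntegral_const, mul_comm]

lemma bg_sKN_cont (K N : ℝ) : Continuous (sKN K N) := by
  unfold sKN
  split_ifs <;> fun_prop

lemma bg_sqrt_mul_lt_pi (K N θ : ℝ) (hN : 1 < N) (hK : 0 < K)
    (hθ : θ < Real.pi * Real.sqrt ((N - 1) / K)) : Real.sqrt (K / (N - 1)) * θ < Real.pi := by
  have hN' : 0 < N - 1 := by linarith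
  have hp : 0 < Real.sqrt (K / (N - 1)) := Real.sqrt_pos.2 (by positivity)
  calc Real.sqrt (K / (N - 1)) * θ
      < Real.sqrt (K / (N - 1)) * (Real.pi * Real.sqrt ((N - 1) / K)) := by gcongr
    _ = Real.pi * (Real.sqrt (K / (N - 1)) * Real.sqrt ((N - 1) / K)) := by ring
    _ = Real.pi := by
      rw [← Real.sqrt_mul (by positivity)]
      have : K / (N - 1) * ((N - 1) / K) = 1 := by field_simp
      rw [this]; simp

lemma bg_sKN_pos (K N R : ℝ) (hN : 1 < N)
    (hRb : 0 < K → R ≤ Real.pi * Real.sqrt ((N - 1) / K)) (θ : ℝ) (hθ : θ ∈ Ioo 0 R) :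
    0 < sKN K N θ := by
  have hN' : 0 < N - 1 := by linarith
  unfold sKN
  split_ifs with h1 h2
  · have hp : 0 < Real.sqrt (K / (N - 1)) := Real.sqrt_pos.2 (by positivity)
    exact Real.sin_pos_of_pos_of_lt_pi (mul_pos hp hθ.1)
      (bg_sqrt_mul_lt_pi K N θ hN h1 (lt_of_lt_of_le hθ.2 (hRb h1)))
  · exact hθ.1
  · have hK : 0 < -K := by
      have : K < 0 := lt_of_le_of_ne (not_lt.1 h1) h2
      linarith
    have hp : 0 < Real.sqrt (-K / (N - 1)) := Real.sqrt_pos.2 (by positivity)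
    exact Real.sinh_pos_iff.2 (mul_pos hp hθ.1)

lemma bg_tau (K N R : ℝ) (hN : 1 < N)
    (hRb : 0 < K → R ≤ Real.pi * Real.sqrt ((N - 1) / K)) :
    ∀ t ∈ Ioo (0:ℝ) 1, ∀ θ ∈ Ioo 0 R,
      tauCoef K N t θ = ENNReal.ofReal (bgphi (sKN K N) N t θ ^ (1 / N)) := by
  intro t ht θ hθ
  have hN0 : 0 < N := by linarith
  have hp1 := bg_sKN_pos K N R hN hRb θ hθ
  have hp2 := bg_sKN_pos K N R hN hRb (t * θ) ⟨mul_pos ht.1 hθ.1, by nlinarith [hθ.1, hθ.2, ht.2]⟩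
  have hq : 0 ≤ sKN K N (t * θ) / sKN K N θ := by positivity
  have e : bgphi (sKN K N) N t θ ^ (1 / N) =
      t ^ (1 / N) * (sKN K N (t * θ) / sKN K N θ) ^ ((N - 1) / N) := by
    unfold bgphi
    rw [Real.mul_rpow ht.1.le (Real.rpow_nonneg hq _), ← Real.rpow_mul hq]
    congr 2
    ring
  rw [e]
  unfold tauCoef sKN
  by_cases h1 : 0 < K
  · simp only [h1, if_true]
    rw [if_neg (not_le.2 (lt_of_lt_of_le hθ.2 (hRb h1)))]
  · by_cases h2 : K = 0
    · simp only [h2, lt_irrefl, if_true, if_false]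
      rw [mul_div_cancel_right₀ _ hθ.1.ne', ← Real.rpow_add ht.1]
      have : 1 / N + (N - 1) / N = 1 := by field_simp; ring
      rw [this, Real.rpow_one]
    · simp only [h1, h2, if_false]

lemma bg_int (K N R : ℝ) (hN : 1 < N)
    (hRb : 0 < K → R ≤ Real.pi * Real.sqrt ((N - 1) / K)) (a : ℝ) (ha : 0 < a) (haR : a ≤ R) :
    ENNReal.ofReal (∫ t in (0:ℝ)..a, sKN K N t ^ (N - 1)) =
      ∫⁻ u in Ioo 0 a, ENNReal.ofReal (sKN K N u ^ (N - 1)) := by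
  have hc : Continuous (fun u => sKN K N u ^ (N - 1)) :=
    (bg_sKN_cont K N).rpow_const fun _ => Or.inr (by linarith)
  rw [intervalIntegral.integral_of_le ha.le, integral_Ioc_eq_integral_Ioo,
    ofReal_integral_eq_lintegral_ofReal]
  · exact (hc.integrableOn_Icc (a := 0) (b := a)).mono_set Ioo_subset_Icc_self
  · filter_upwards [ae_restrict_mem measurableSet_Ioo] with u hu
    exact (Real.rpow_pos_of_pos
      (bg_sKN_pos K N R hN hRb u ⟨hu.1, lt_of_lt_of_le hu.2 haR⟩) _).le

/-- **Bishop–Gromov volume growth inequality** (integrated form). -/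
theorem bishop_gromov
    {X : Type*} [MetricSpace X] [CompleteSpace X] [TopologicalSpace.SeparableSpace X]
    [MeasurableSpace X] [BorelSpace X] (m : Measure X) [IsLocallyFiniteMeasure m]
    (hsupp : mmSupp m = Set.univ) (K N : ℝ) (hN : 1 < N) (hCD : CD K N m)
    (x₀ : X) (r R : ℝ) (hr : 0 < r) (hrR : r < R)
    (hRb : 0 < K → R ≤ Real.pi * Real.sqrt ((N - 1) / K)) :
    m (Metric.ball x₀ r) * ENNReal.ofReal (∫ t in (0:ℝ)..R, sKN K N t ^ (N - 1)) ≥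
      m (Metric.ball x₀ R) * ENNReal.ofReal (∫ t in (0:ℝ)..r, sKN K N t ^ (N - 1)) := by
  have hsec : SecondCountableTopology X := UniformSpace.secondCountable_of_separable X
  have hR : 0 < R := by linarith
  have hs := bg_sKN_pos K N R hN hRb
  rw [bg_int K N R hN hRb R hR le_rfl, bg_int K N R hN hRb r hr hrR.le]
  set σ : ℝ → ℝ≥0∞ := fun u => ENNReal.ofReal (sKN K N u ^ (N - 1)) with hσ
  have hsplit : ∫⁻ u in Ioo 0 R, σ u = (∫⁻ u in Ioo 0 r, σ u) + ∫⁻ u in Ico r R, σ u := by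
    rw [← lintegral_union measurableSet_Ico, Ioo_union_Ico_eq_Ioo hr hrR.le]
    rw [Set.disjoint_left]
    intro u h1 h2
    exact absurd h1.2 (not_lt.2 h2.1)
  have hpos : ∫⁻ u in Ico r R, σ u ≠ 0 := by
    have hσm : Measurable σ := by
      have := (bg_sKN_cont K N).measurable
      rw [hσ]; fun_prop
    rw [← pos_iff_ne_zero, setLIntegral_pos_iff hσm]
    have hsub : Ico r R ⊆ Function.support σ ∩ Ico r R := by
      intro u hu
      refine ⟨?_, hu⟩
      have := Real.rpow_pos_of_pos (hs u ⟨lt_of_lt_of_le hr hu.1, hu.2⟩) (N - 1)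
      simp only [Function.mem_support, hσ, ne_eq, ENNReal.ofReal_eq_zero, not_le]
      exact this
    refine lt_of_lt_of_le ?_ (measure_mono hsub)
    simp [hrR]
  by_cases hmr : m (Metric.ball x₀ r) = ∞
  · rw [hmr, ENNReal.top_mul (by rw [hsplit]; simp [hpos])]
    exact le_top
  have hball : m (Metric.ball x₀ R) ≤ m (Metric.ball x₀ r) + m (Metric.ball x₀ R \ Metric.ball x₀ r) := by
    refine (measure_mono ?_).trans (measure_union_le _ _)
    intro z hz
    by_cases h : z ∈ Metric.ball x₀ r
    · exact Or.inl h
    · exact Or.inr ⟨hz, h⟩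
  obtain ⟨Rseq, hmono, hlt, hlim⟩ := exists_seq_strictMono_tendsto R
  let T : ℕ → Set X := fun n => (spanningSets m n ∩ {z | dist z x₀ ≤ Rseq n}) \ Metric.ball x₀ r
  have hTm : ∀ n, MeasurableSet (T n) := fun n =>
    ((measurableSet_spanningSets m n).inter (measurableSet_le (by fun_prop) (by fun_prop))).diff
      measurableSet_ball
  have hTmono : Monotone T := by
    intro i j hij z hz
    exact ⟨⟨monotone_spanningSets m hij hz.1.1, le_trans hz.1.2 (hmono.monotone hij)⟩, hz.2⟩
  have hTU : Metric.ball x₀ R \ Metric.ball x₀ r ⊆ ⋃ n, T n := by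
    intro z hz
    obtain ⟨n1, hn1⟩ : ∃ n, z ∈ spanningSets m n := by
      have : z ∈ ⋃ n, spanningSets m n := by rw [iUnion_spanningSets]; trivial
      exact mem_iUnion.1 this
    obtain ⟨n2, hn2⟩ : ∃ n, dist z x₀ < Rseq n := (hlim.eventually_const_lt hz.1).exists
    refine mem_iUnion.2 ⟨max n1 n2, ⟨monotone_spanningSets m (le_max_left _ _) hn1, ?_⟩, hz.2⟩
    exact hn2.le.trans (hmono.monotone (le_max_right _ _))
  have hcore : m (Metric.ball x₀ R \ Metric.ball x₀ r) * ∫⁻ u in Ioo 0 r, σ u ≤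
      m (Metric.ball x₀ r) * ∫⁻ u in Ico r R, σ u := by
    calc m (Metric.ball x₀ R \ Metric.ball x₀ r) * ∫⁻ u in Ioo 0 r, σ u
        ≤ m (⋃ n, T n) * ∫⁻ u in Ioo 0 r, σ u := by gcongr
      _ = ⨆ n, m (T n) * ∫⁻ u in Ioo 0 r, σ u := by
          rw [hTmono.measure_iUnion, ENNReal.iSup_mul]
      _ ≤ _ := by
          refine iSup_le fun n => ?_
          refine bg_core m hsupp K N hN hCD (sKN K N) (bg_sKN_cont K N) R hs (bg_tau K N R hN hRb)
            x₀ r (Rseq n) hr hrR (hlt n) hmr (T n) (hTm n) ?_ ?_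
          · exact ne_top_of_le_ne_top (measure_spanningSets_lt_top m n).ne
              (measure_mono fun z hz => hz.1.1)
          · exact fun y hy => ⟨not_lt.1 hy.2, hy.1.2⟩
  calc m (Metric.ball x₀ R) * ∫⁻ u in Ioo 0 r, σ u
      ≤ (m (Metric.ball x₀ r) + m (Metric.ball x₀ R \ Metric.ball x₀ r)) * ∫⁻ u in Ioo 0 r, σ u := by
        gcongr
    _ = m (Metric.ball x₀ r) * (∫⁻ u in Ioo 0 r, σ u)
        + m (Metric.ball x₀ R \ Metric.ball x₀ r) * ∫⁻ u in Ioo 0 r, σ u := add_mul _ _ _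
    _ ≤ m (Metric.ball x₀ r) * (∫⁻ u in Ioo 0 r, σ u)
        + m (Metric.ball x₀ r) * ∫⁻ u in Ico r R, σ u := by gcongr
    _ = m (Metric.ball x₀ r) * ∫⁻ u in Ioo 0 R, σ u := by rw [hsplit, mul_add]


end
end

section
/- Let (X,d,m) be an mm-space satisfying CD(K,∞) for some K ∈ ℝ, and let x₀ ∈ supp m. Then there exist constants c₀, c₁ ∈ ℝ such that for all R ≥ 1: m(B_R(x₀)) ≤ exp( (K⁻/2)·R² + c₁·R + c₀ ), where K⁻ = max(−K, 0) and B_R(x₀) is the open ball of radius R around x₀. -/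
open MeasureTheory Filter Set Topology ENNReal
open scoped Classical

noncomputable section

/-- If the entropy integrand is integrable, the entropy is its integral. -/
theorem ent_eq_of_integrable {α : Type*} [MeasurableSpace α] {μ m : Measure α}
    (h : μ ≪ m) (hi : Integrable (entFun μ m) m) :
    Ent μ m = ((∫ x, entFun μ m x ∂m : ℝ) : EReal) := by
  have hp : Integrable (fun x => max (entFun μ m x) 0) m := hi.pos_part
  have hn : Integrable (fun x => max (-(entFun μ m x)) 0) m := hi.neg_part
  have e1 : (∫⁻ x, ENNReal.ofReal (-(entFun μ m x)) ∂m)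
      = ENNReal.ofReal (∫ x, max (-(entFun μ m x)) 0 ∂m) := by
    rw [ofReal_integral_eq_lintegral_ofReal hn (ae_of_all _ fun x => le_max_right _ _)]
    refine lintegral_congr fun x => ?_
    rcases le_total (-(entFun μ m x)) 0 with h0 | h0
    · rw [max_eq_right h0, ENNReal.ofReal_of_nonpos h0, ENNReal.ofReal_zero]
    · rw [max_eq_left h0]
  have e2 : ∫ x, entFun μ m x ∂m
      = (∫ x, max (entFun μ m x) 0 ∂m) - ∫ x, max (-(entFun μ m x)) 0 ∂m := by
    rw [← integral_sub hp hn]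
    refine integral_congr_ae (ae_of_all _ fun x => ?_)
    change entFun μ m x = max (entFun μ m x) 0 - max (-(entFun μ m x)) 0
    rcases le_total (entFun μ m x) 0 with h0 | h0
    · rw [max_eq_right h0, max_eq_left (by linarith)]; ring
    · rw [max_eq_left h0, max_eq_right (by linarith)]; ring
  have e3 : 0 ≤ ∫ x, max (-(entFun μ m x)) 0 ∂m := integral_nonneg fun x => le_max_right _ _
  rw [Ent, if_pos ⟨h, hp⟩, e1, e2, EReal.coe_ennreal_ofReal, max_eq_left e3, EReal.coe_sub]

/-- The uniform distribution on a set. -/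
def unif {α : Type*} [MeasurableSpace α] (m : Measure α) (A : Set α) : Measure α :=
  (m A)⁻¹ • m.restrict A

theorem unif_prob {α : Type*} [MeasurableSpace α] {m : Measure α} {A : Set α}
    (h0 : m A ≠ 0) (h1 : m A ≠ ∞) : IsProbabilityMeasure (unif m A) := by
  constructor
  simp [unif, ENNReal.inv_mul_cancel h0 h1]

theorem unif_ae {α : Type*} [MeasurableSpace α] {m : Measure α} {A : Set α}
    (hA : MeasurableSet A) : ∀ᵐ x ∂(unif m A), x ∈ A :=
  Measure.ae_smul_measure (ae_restrict_mem hA) _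

theorem unif_ent {α : Type*} [MeasurableSpace α] {m : Measure α} [SigmaFinite m] {A : Set α}
    (hA : MeasurableSet A) (h0 : m A ≠ 0) (h1 : m A ≠ ∞) :
    Ent (unif m A) m = ((-Real.log (m A).toReal : ℝ) : EReal) := by
  have hw : unif m A = m.withDensity (A.indicator fun _ => (m A)⁻¹) := by
    rw [withDensity_indicator hA, withDensity_const, unif]
  have hr : (unif m A).rnDeriv m =ᵐ[m] A.indicator fun _ => (m A)⁻¹ := by
    rw [hw]; exact Measure.rnDeriv_withDensity _ (measurable_const.indicator hA)
  have hac : unif m A ≪ m := by rw [hw]; exact withDensity_absolutelyContinuous _ _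
  have he : entFun (unif m A) m
      =ᵐ[m] A.indicator fun _ => ((m A).toReal)⁻¹ * Real.log ((m A).toReal)⁻¹ := by
    filter_upwards [hr] with x hx
    rw [entFun, hx]
    by_cases hxA : x ∈ A <;> simp [hxA]
  have hi : Integrable (A.indicator fun _ => ((m A).toReal)⁻¹ * Real.log ((m A).toReal)⁻¹) m := by
    rw [integrable_indicator_iff hA]
    exact integrableOn_const h1
  rw [ent_eq_of_integrable hac (hi.congr he.symm), integral_congr_ae he, integral_indicator hA,
    setIntegral_const, Real.log_inv, smul_eq_mul, measureReal_def]
  have : (m A).toReal ≠ 0 := (ENNReal.toReal_pos h0 h1).ne'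
  congr 1
  field_simp

/-- Jensen: entropy lower bound for measures concentrated on a set of finite mass. -/
theorem ent_lower {α : Type*} [MeasurableSpace α] {m μ : Measure α} [SigmaFinite m]
    [IsProbabilityMeasure μ] {B : Set α}
    (hB : MeasurableSet B) (h0 : m B ≠ 0) (h1 : m B ≠ ∞) (hμ : μ Bᶜ = 0) :
    ((-Real.log (m B).toReal : ℝ) : EReal) ≤ Ent μ m := by
  by_cases hE : μ ≪ m ∧ Integrable (fun x => max (entFun μ m x) 0) m
  swap
  · rw [Ent, if_neg hE]; exact le_top
  obtain ⟨hac, hp⟩ := hE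
  set b := (m B).toReal with hb
  have hbpos : 0 < b := ENNReal.toReal_pos h0 h1
  set ρ : α → ℝ := fun x => (μ.rnDeriv m x).toReal with hρ
  have hρi : Integrable ρ m := Measure.integrable_toReal_rnDeriv
  have hρ1 : ∫ x, ρ x ∂m = 1 := by
    rw [hρ, Measure.integral_toReal_rnDeriv hac]; simp
  have hρ0 : ∀ᵐ x ∂m, x ∉ B → ρ x = 0 := by
    have h2 : ∫⁻ x in Bᶜ, μ.rnDeriv m x ∂m = 0 := by
      rw [Measure.setLIntegral_rnDeriv hac, hμ]
    rw [lintegral_eq_zero_iff (Measure.measurable_rnDeriv _ _)] at h2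
    have h3 := (ae_restrict_iff' hB.compl).1 h2
    filter_upwards [h3] with x hx hxB
    simp [hρ, hx hxB]
  set g : α → ℝ := fun x => (1 - Real.log b) * ρ x - B.indicator (fun _ => b⁻¹) x with hg
  have hci : Integrable (B.indicator fun _ => b⁻¹) m := by
    rw [integrable_indicator_iff hB]; exact integrableOn_const h1
  have hgi : Integrable g m := (hρi.const_mul _).sub hci
  have hge : ∀ᵐ x ∂m, g x ≤ entFun μ m x := by
    filter_upwards [hρ0] with x hx
    change g x ≤ ρ x * Real.log (ρ x)
    by_cases hxB : x ∈ B
    · have hx0 : 0 ≤ ρ x := ENNReal.toReal_nonneg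
      simp only [hg, indicator_of_mem hxB]
      rcases hx0.eq_or_lt with h | h
      · rw [← h]; simp; positivity
      · have := Real.one_sub_inv_le_log_of_pos (mul_pos h hbpos)
        rw [Real.log_mul h.ne' hbpos.ne'] at this
        have h4 := mul_le_mul_of_nonneg_left this hx0
        have h5 : ρ x * (1 - (ρ x * b)⁻¹) = ρ x - b⁻¹ := by field_simp
        rw [h5] at h4
        linarith
    · simp [hg, hxB, hx hxB]
  have hmeas : Measurable (entFun μ m) := by
    have : Measurable ρ := (Measure.measurable_rnDeriv _ _).ennreal_toReal
    exact this.mul (Real.measurable_log.comp this)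
  have hi : Integrable (entFun μ m) m := by
    refine Integrable.mono' (hp.add hgi.abs) hmeas.aestronglyMeasurable ?_
    filter_upwards [hge] with x hx
    rw [Real.norm_eq_abs]
    change |entFun μ m x| ≤ max (entFun μ m x) 0 + |g x|
    rcases le_total 0 (entFun μ m x) with h | h
    · rw [abs_of_nonneg h, max_eq_left h]; linarith [abs_nonneg (g x)]
    · rw [abs_of_nonpos h, max_eq_right h]; linarith [neg_abs_le (g x)]
  rw [ent_eq_of_integrable hac hi, EReal.coe_le_coe_iff]
  calc -Real.log b = ∫ x, g x ∂m := by
        rw [hg, integral_sub (hρi.const_mul _) hci, integral_const_mul, hρ1, integral_indicator hB,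
          setIntegral_const, measureReal_def, ← hb, smul_eq_mul, mul_inv_cancel₀ hbpos.ne']
        ring
    _ ≤ _ := integral_mono_ae hgi hi hge

theorem coupling_prob {α β : Type*} [MeasurableSpace α] [MeasurableSpace β]
    {q : Measure (α × β)} {μ : Measure α} {ν : Measure β} [IsProbabilityMeasure μ]
    (h : IsCoupling q μ ν) : IsProbabilityMeasure q := by
  constructor
  have : (Measure.map Prod.fst q) univ = 1 := by rw [h.1]; simp
  rwa [Measure.map_apply measurable_fst MeasurableSet.univ, preimage_univ] at this

theorem coupling_prob_right {α β : Type*} [MeasurableSpace α] [MeasurableSpace β]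
    {q : Measure (α × β)} {μ : Measure α} {ν : Measure β} [IsProbabilityMeasure μ]
    (h : IsCoupling q μ ν) : IsProbabilityMeasure ν := by
  have := coupling_prob h
  rw [← h.2]
  exact Measure.isProbabilityMeasure_map measurable_snd.aemeasurable

open ProbabilityTheory in
/-- Gluing of two couplings. -/
theorem gluing {X : Type*} [MeasurableSpace X] [StandardBorelSpace X]
    {μ ν ξ : Measure X} [IsProbabilityMeasure μ] {q₁ q₂ : Measure (X × X)}
    (h₁ : IsCoupling q₁ μ ν) (h₂ : IsCoupling q₂ ν ξ) :
    ∃ p : Measure ((X × X) × X), Measure.map Prod.fst p = q₁ ∧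
      Measure.map (fun w => (w.1.2, w.2)) p = q₂ := by
  have i1 := coupling_prob h₁
  have i2 := coupling_prob_right h₁
  have i3 := coupling_prob h₂
  have : Nonempty X := by
    by_contra hX
    rw [not_nonempty_iff] at hX
    have : μ univ = 1 := measure_univ
    rw [Measure.eq_zero_of_isEmpty μ] at this
    simp at this
  refine ⟨q₁ ⊗ₘ (q₂.condKernel.comap Prod.snd measurable_snd), ?_, ?_⟩
  · exact Measure.fst_compProd _ _
  · have hm : Measurable (fun w : (X × X) × X => (w.1.2, w.2)) := by fun_prop
    have hν : ν = q₂.fst := h₂.1.symm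
    conv_rhs => rw [← q₂.disintegrate q₂.condKernel, ← hν, ← h₁.2]
    refine Measure.ext_of_lintegral _ fun f hf => ?_
    have hfm : Measurable (fun w : (X × X) × X => f (w.1.2, w.2)) := hf.comp hm
    rw [lintegral_map hf hm, Measure.lintegral_compProd hfm,
      Measure.lintegral_compProd hf, lintegral_map _ measurable_snd]
    · rfl
    · exact hf.lintegral_kernel_prod_right'

/-- Pointwise inequality. -/
theorem pointwise_ineq {X : Type*} [MetricSpace X] {x y z x₀ : X} {t ε R : ℝ}
    (hε : 0 < ε) (hε2 : ε ≤ 1/2) (hR : 1 ≤ R) (ht : t = ε / R)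
    (hx : dist x x₀ < ε) (hy : dist y x₀ < R) :
    edist x y ^ 2 + (Metric.ball x₀ (3*ε))ᶜ.indicator (fun _ => ENNReal.ofReal ((ε/2)^2)) z ≤
      ENNReal.ofReal (1/t) * edist x z ^ 2 + ENNReal.ofReal (1/(1-t)) * edist z y ^ 2 := by
  have hR0 : 0 < R := by linarith
  have htR : t * R = ε := by rw [ht]; field_simp
  have ht0 : 0 < t := by rw [ht]; positivity
  have ht1 : t ≤ 1/2 := by nlinarith
  have key : dist x y ^ 2 + ((1-t) * dist x z - t * (dist x y - dist x z))^2
      ≤ 1/t * dist x z ^ 2 + 1/(1-t) * dist z y ^ 2 := by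
    set a := dist x z
    set b := dist z y
    set D := dist x y
    have hb0 : 0 ≤ b := dist_nonneg
    have h1 : D ≤ a + b := dist_triangle x z y
    have h2 : a ≤ D + b := by
      have := dist_triangle x y z
      rwa [dist_comm y z] at this
    have h3 : (D - a)^2 ≤ b^2 := by
      apply sq_le_sq'  <;> linarith
    have h4 : 1/t * a^2 + 1/(1-t) * (D-a)^2 - D^2 = ((1-t)*a - t*(D-a))^2 / (t*(1-t)) := by
      have : (1 - t) ≠ 0 := by linarith
      field_simp
      ring
    have h5 : ((1-t)*a - t*(D-a))^2 ≤ ((1-t)*a - t*(D-a))^2 / (t*(1-t)) := by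
      rw [le_div_iff₀ (by nlinarith)]
      nlinarith [sq_nonneg ((1-t)*a - t*(D-a)), sq_nonneg (t-1/2)]
    have h6 : 1/(1-t) * (D-a)^2 ≤ 1/(1-t) * b^2 :=
      mul_le_mul_of_nonneg_left h3 (one_div_nonneg.2 (by linarith))
    linarith
  have hD : dist x y ≤ R + ε := by
    have := dist_triangle_right x y x₀
    linarith
  have hreal : dist x y ^ 2 + (Metric.ball x₀ (3*ε))ᶜ.indicator (fun _ => (ε/2)^2) z
      ≤ 1/t * dist x z ^ 2 + 1/(1-t) * dist z y ^ 2 := by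
    refine le_trans ?_ key
    by_cases hz : z ∈ (Metric.ball x₀ (3*ε))ᶜ
    · rw [indicator_of_mem hz]
      have hz' : 3 * ε ≤ dist z x₀ := by simpa using hz
      have := dist_triangle_left z x₀ x
      have h7 : ε/2 ≤ (1-t) * dist x z - t * (dist x y - dist x z) := by
        nlinarith
      have := pow_le_pow_left₀ (by positivity) h7 2
      linarith
    · rw [indicator_of_notMem hz]
      nlinarith [sq_nonneg ((1-t) * dist x z - t * (dist x y - dist x z))]
  have := ENNReal.ofReal_le_ofReal hreal
  have ht' : 0 ≤ 1/(1-t) := one_div_nonneg.2 (by linarith)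
  have ht'' : 0 ≤ 1/t := one_div_nonneg.2 ht0.le
  rw [ENNReal.ofReal_add (by positivity) (indicator_nonneg (fun _ _ => by positivity) _),
    ENNReal.ofReal_add (by positivity) (by positivity),
    ENNReal.ofReal_mul ht'', ENNReal.ofReal_mul ht', ENNReal.ofReal_pow dist_nonneg,
    ENNReal.ofReal_pow dist_nonneg, ENNReal.ofReal_pow dist_nonneg, ← edist_dist, ← edist_dist,
    ← edist_dist] at this
  convert this using 2
  by_cases hz : z ∈ (Metric.ball x₀ (3*ε))ᶜ
  · rw [indicator_of_mem hz, indicator_of_mem hz]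
  · rw [indicator_of_notMem hz, indicator_of_notMem hz, ENNReal.ofReal_zero]

theorem Wsq_of_geodesic {X : Type*} [MetricSpace X] [MeasurableSpace X] {μ ν μ' ν' : Measure X}
    {c : ℝ} (hc : 0 ≤ c) (h : W2 μ ν = ENNReal.ofReal c * W2 μ' ν') :
    Wsq μ ν = ENNReal.ofReal (c^2) * Wsq μ' ν' := by
  have h2 : ∀ a : ℝ≥0∞, (a ^ (1/2:ℝ)) ^ 2 = a := fun a => by
    rw [← ENNReal.rpow_natCast, ← ENNReal.rpow_mul]; norm_num
  have := congrArg (· ^ 2) h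
  simp only [W2, mul_pow, h2] at this
  rw [this, ENNReal.ofReal_pow hc]

theorem exists_coupling_lt {X : Type*} [MetricSpace X] [MeasurableSpace X] {μ ν : Measure X}
    {c : ℝ≥0∞} (h : Wsq μ ν < c) :
    ∃ q, IsCoupling q μ ν ∧ ∫⁻ p, edist p.1 p.2 ^ 2 ∂q < c := by
  simp only [Wsq, iInf_lt_iff] at h
  obtain ⟨q, hq, h⟩ := h
  exact ⟨q, hq, h⟩

/-- Concentration of the intermediate point of the geodesic. -/
theorem concentration {X : Type*} [MetricSpace X] [CompleteSpace X]
    [TopologicalSpace.SeparableSpace X] [MeasurableSpace X] [BorelSpace X]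
    {μ ν ξ : Measure X} [IsProbabilityMeasure μ] [IsProbabilityMeasure ξ] {x₀ : X} {t ε R : ℝ}
    (hε : 0 < ε) (hε2 : ε ≤ 1/2) (hR : 1 ≤ R) (ht : t = ε / R)
    (hμ : ∀ᵐ x ∂μ, dist x x₀ < ε) (hξ : ∀ᵐ y ∂ξ, dist y x₀ < R)
    (hW : Wsq μ ξ ≠ ∞)
    (h₁ : Wsq μ ν = ENNReal.ofReal (t^2) * Wsq μ ξ)
    (h₂ : Wsq ν ξ = ENNReal.ofReal ((1-t)^2) * Wsq μ ξ) :
    ν (Metric.ball x₀ (3*ε))ᶜ = 0 := by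
  have : SecondCountableTopology X := UniformSpace.secondCountable_of_separable X
  have : PolishSpace X := inferInstance
  have hR0 : 0 < R := by linarith
  have htR : t * R = ε := by rw [ht]; field_simp
  have ht0 : 0 < t := by rw [ht]; positivity
  have ht1 : t ≤ 1/2 := by nlinarith
  set W := Wsq μ ξ with hWdef
  set κ := ENNReal.ofReal ((ε/2)^2) with hκ
  have hκ0 : κ ≠ 0 := by simp [hκ]; positivity
  have hκt : κ ≠ ∞ := ENNReal.ofReal_ne_top
  set C := ENNReal.ofReal (1/t) + ENNReal.ofReal (1/(1-t)) with hC
  have hCt : C ≠ ∞ := by simp [hC]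
  have main : ∀ δ : ℝ≥0∞, 0 < δ → W + κ * ν (Metric.ball x₀ (3*ε))ᶜ ≤ W + C * δ := by
    intro δ hδ
    have hf1 : Wsq μ ν ≠ ∞ := by rw [h₁]; exact ENNReal.mul_ne_top ENNReal.ofReal_ne_top hW
    have hf2 : Wsq ν ξ ≠ ∞ := by rw [h₂]; exact ENNReal.mul_ne_top ENNReal.ofReal_ne_top hW
    obtain ⟨q₁, hq₁, hl₁⟩ := exists_coupling_lt (ENNReal.lt_add_right hf1 hδ.ne')
    obtain ⟨q₂, hq₂, hl₂⟩ := exists_coupling_lt (ENNReal.lt_add_right hf2 hδ.ne')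
    obtain ⟨p, hp₁, hp₂⟩ := gluing hq₁ hq₂
    have mz : Measurable (fun w : (X × X) × X => w.1.2) := by fun_prop
    have mx : Measurable (fun w : (X × X) × X => w.1.1) := by fun_prop
    have my : Measurable (fun w : (X × X) × X => w.2) := by fun_prop
    have mzy : Measurable (fun w : (X × X) × X => (w.1.2, w.2)) := by fun_prop
    have mxy : Measurable (fun w : (X × X) × X => (w.1.1, w.2)) := by fun_prop
    have med : Measurable (fun w : X × X => edist w.1 w.2 ^ 2) :=
      (measurable_fst.edist measurable_snd).pow_const 2
    have m1 : Measurable (fun w : (X × X) × X => edist w.1.1 w.2 ^ 2) := med.comp mxy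
    have m2 : Measurable (fun w : (X × X) × X => edist w.1.1 w.1.2 ^ 2) := med.comp measurable_fst
    have m3 : Measurable (fun w : (X × X) × X => edist w.1.2 w.2 ^ 2) := med.comp mzy
    have px : Measure.map (fun w : (X × X) × X => w.1.1) p = μ := by
      rw [← hq₁.1, ← hp₁, Measure.map_map measurable_fst measurable_fst]; rfl
    have pz : Measure.map (fun w : (X × X) × X => w.1.2) p = ν := by
      rw [← hq₁.2, ← hp₁, Measure.map_map measurable_snd measurable_fst]; rfl
    have py : Measure.map (fun w : (X × X) × X => w.2) p = ξ := by
      rw [← hq₂.2, ← hp₂, Measure.map_map measurable_snd mzy]; rfl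
    have pxy : IsCoupling (Measure.map (fun w : (X × X) × X => (w.1.1, w.2)) p) μ ξ := by
      constructor
      · rw [Measure.map_map measurable_fst mxy, ← px]; rfl
      · rw [Measure.map_map measurable_snd mxy, ← py]; rfl
    have hWle : W ≤ ∫⁻ w, edist w.1.1 w.2 ^ 2 ∂p := by
      have : W ≤ ∫⁻ w, edist w.1 w.2 ^ 2 ∂(Measure.map (fun w : (X × X) × X => (w.1.1, w.2)) p) :=
        iInf₂_le (f := fun (q : Measure (X × X)) (_ : IsCoupling q μ ξ) =>
          ∫⁻ p, edist p.1 p.2 ^ 2 ∂q) _ pxy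
      rwa [lintegral_map med mxy] at this
    have e1 : ∫⁻ w, edist w.1.1 w.1.2 ^ 2 ∂p = ∫⁻ w, edist w.1 w.2 ^ 2 ∂q₁ := by
      rw [← hp₁, lintegral_map med measurable_fst]
    have e2 : ∫⁻ w, edist w.1.2 w.2 ^ 2 ∂p = ∫⁻ w, edist w.1 w.2 ^ 2 ∂q₂ := by
      rw [← hp₂, lintegral_map med mzy]
    have mB : MeasurableSet (Metric.ball x₀ (3*ε))ᶜ := Metric.isOpen_ball.measurableSet.compl
    have e3 : ∫⁻ w, (Metric.ball x₀ (3*ε))ᶜ.indicator (fun _ => κ) w.1.2 ∂p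
        = κ * ν (Metric.ball x₀ (3*ε))ᶜ := by
      rw [← lintegral_map (μ := p) (measurable_const.indicator mB) mz, pz,
        lintegral_indicator_const mB]
    have ax : ∀ᵐ w ∂p, dist w.1.1 x₀ < ε := by
      rw [← px] at hμ; exact ae_of_ae_map mx.aemeasurable hμ
    have ay : ∀ᵐ w ∂p, dist w.2 x₀ < R := by
      rw [← py] at hξ; exact ae_of_ae_map my.aemeasurable hξ
    calc W + κ * ν (Metric.ball x₀ (3*ε))ᶜ
        ≤ ∫⁻ w, edist w.1.1 w.2 ^ 2 ∂p
          + ∫⁻ w, (Metric.ball x₀ (3*ε))ᶜ.indicator (fun _ => κ) w.1.2 ∂p := by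
          rw [e3]; gcongr
      _ = ∫⁻ w, (edist w.1.1 w.2 ^ 2
          + (Metric.ball x₀ (3*ε))ᶜ.indicator (fun _ => κ) w.1.2) ∂p := by
          rw [lintegral_add_left m1]
      _ ≤ ∫⁻ w, (ENNReal.ofReal (1/t) * edist w.1.1 w.1.2 ^ 2
          + ENNReal.ofReal (1/(1-t)) * edist w.1.2 w.2 ^ 2) ∂p := by
          refine lintegral_mono_ae ?_
          filter_upwards [ax, ay] with w hx hy
          exact pointwise_ineq hε hε2 hR ht hx hy
      _ = ENNReal.ofReal (1/t) * ∫⁻ w, edist w.1 w.2 ^ 2 ∂q₁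
          + ENNReal.ofReal (1/(1-t)) * ∫⁻ w, edist w.1 w.2 ^ 2 ∂q₂ := by
          rw [lintegral_add_left (m2.const_mul _), lintegral_const_mul _ m2,
            lintegral_const_mul _ m3, ← e1, ← e2]
      _ ≤ ENNReal.ofReal (1/t) * (Wsq μ ν + δ) + ENNReal.ofReal (1/(1-t)) * (Wsq ν ξ + δ) := by
          gcongr
      _ = W + C * δ := by
          have ht2 : 0 < 1 - t := by linarith
          rw [h₁, h₂, mul_add, mul_add, ← mul_assoc, ← mul_assoc,
            ← ENNReal.ofReal_mul (by positivity), ← ENNReal.ofReal_mul (by positivity)]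
          have r1 : 1/t * t^2 = t := by field_simp
          have r2 : 1/(1-t) * (1-t)^2 = 1-t := by field_simp
          rw [r1, r2]
          have r3 : ENNReal.ofReal t + ENNReal.ofReal (1-t) = 1 := by
            rw [← ENNReal.ofReal_add ht0.le ht2.le]; simp
          calc _ = (ENNReal.ofReal t + ENNReal.ofReal (1-t)) * W + C * δ := by rw [hC]; ring
            _ = _ := by rw [r3, one_mul]
  have h3 : κ * ν (Metric.ball x₀ (3*ε))ᶜ = 0 := by
    by_contra hne
    have hpos : 0 < κ * ν (Metric.ball x₀ (3*ε))ᶜ := pos_iff_ne_zero.2 hne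
    obtain ⟨δ, hδ, hδ'⟩ : ∃ δ : ℝ≥0∞, 0 < δ ∧ C * δ < κ * ν (Metric.ball x₀ (3*ε))ᶜ := by
      have hT : Tendsto (fun δ : ℝ≥0∞ => C * δ) (𝓝[>] 0) (𝓝 (C * 0)) :=
        (ENNReal.Tendsto.const_mul tendsto_id (Or.inr hCt)).mono_left nhdsWithin_le_nhds
      rw [mul_zero] at hT
      have := (hT.eventually (gt_mem_nhds hpos)).and self_mem_nhdsWithin
      obtain ⟨δ, h1, h2⟩ := this.exists
      exact ⟨δ, h2, h1⟩
    have := main δ hδ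
    rw [ENNReal.add_le_add_iff_left hW] at this
    exact absurd this (not_le.2 hδ')
  exact (mul_eq_zero.1 h3).resolve_left hκ0

theorem Wsq_le_of_bounded {X : Type*} [MetricSpace X]
    [TopologicalSpace.SeparableSpace X] [MeasurableSpace X] [BorelSpace X]
    {μ ξ : Measure X} [IsProbabilityMeasure μ] [IsProbabilityMeasure ξ] {x₀ : X} {ε R : ℝ}
    (hε : 0 < ε) (hR : 0 < R)
    (hμ : ∀ᵐ x ∂μ, dist x x₀ < ε) (hξ : ∀ᵐ y ∂ξ, dist y x₀ < R) :
    Wsq μ ξ ≤ ENNReal.ofReal ((R + ε)^2) := by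
  have hc : IsCoupling (μ.prod ξ) μ ξ := by
    constructor
    · exact Measure.fst_prod
    · exact Measure.snd_prod
  have ax : ∀ᵐ w ∂(μ.prod ξ), dist w.1 x₀ < ε := by
    rw [← hc.1] at hμ; exact ae_of_ae_map measurable_fst.aemeasurable hμ
  have ay : ∀ᵐ w ∂(μ.prod ξ), dist w.2 x₀ < R := by
    rw [← hc.2] at hξ; exact ae_of_ae_map measurable_snd.aemeasurable hξ
  calc Wsq μ ξ ≤ ∫⁻ w, edist w.1 w.2 ^ 2 ∂(μ.prod ξ) :=
      iInf₂_le (f := fun (q : Measure (X × X)) (_ : IsCoupling q μ ξ) =>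
          ∫⁻ p, edist p.1 p.2 ^ 2 ∂q) _ hc
    _ ≤ ∫⁻ w, ENNReal.ofReal ((R + ε)^2) ∂(μ.prod ξ) := by
      refine lintegral_mono_ae ?_
      filter_upwards [ax, ay] with w hx hy
      rw [edist_dist, ← ENNReal.ofReal_pow dist_nonneg]
      refine ENNReal.ofReal_le_ofReal (pow_le_pow_left₀ dist_nonneg ?_ 2)
      linarith [dist_triangle_right w.1 w.2 x₀]
    _ = _ := by simp

theorem memP2_of_bounded {X : Type*} [MetricSpace X] [MeasurableSpace X]
    {μ : Measure X} [IsProbabilityMeasure μ] {x₀ : X} {R : ℝ}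
    (hμ : ∀ᵐ x ∂μ, dist x x₀ < R) : MemP2 μ := by
  refine ⟨inferInstance, x₀, ?_⟩
  calc ∫⁻ x, edist x x₀ ^ 2 ∂μ ≤ ∫⁻ x, ENNReal.ofReal (R^2) ∂μ := by
        refine lintegral_mono_ae ?_
        filter_upwards [hμ] with w hx
        rw [edist_dist, ← ENNReal.ofReal_pow dist_nonneg]
        exact ENNReal.ofReal_le_ofReal (pow_le_pow_left₀ dist_nonneg hx.le 2)
    _ < ∞ := by simp

/-- The estimate for subsets of finite measure. -/
theorem finite_set_bound {X : Type*} [MetricSpace X] [CompleteSpace X]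
    [TopologicalSpace.SeparableSpace X]
    [MeasurableSpace X] [BorelSpace X] (m : Measure X) [SigmaFinite m]
    (K : ℝ) (hCD : CDinfty K m) (x₀ : X) {ε R : ℝ} (hε : 0 < ε) (hε2 : ε ≤ 1/2) (hR : 1 ≤ R)
    (ha : m (Metric.ball x₀ ε) ≠ 0) (hb : m (Metric.ball x₀ (3*ε)) ≠ ∞)
    {A : Set X} (hA : MeasurableSet A) (hAR : A ⊆ Metric.ball x₀ R) (h0 : m A ≠ 0)
    (h1 : m A ≠ ∞) :
    Real.log (m A).toReal ≤ max (-K) 0 / 2 * R ^ 2 +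
      ((Real.log (m (Metric.ball x₀ (3*ε))).toReal - Real.log (m (Metric.ball x₀ ε)).toReal) / ε
        + max (-K) 0 * ε) * R
      + (Real.log (m (Metric.ball x₀ ε)).toReal + max (-K) 0 / 2 * ε^2) := by
  have hsub : Metric.ball x₀ ε ⊆ Metric.ball x₀ (3*ε) := Metric.ball_subset_ball (by linarith)
  have ha1 : m (Metric.ball x₀ ε) ≠ ∞ := ne_top_of_le_ne_top hb (measure_mono hsub)
  have hb0 : m (Metric.ball x₀ (3*ε)) ≠ 0 := fun h => ha (measure_mono_null hsub h)
  have mball : ∀ r, MeasurableSet (Metric.ball x₀ r) := fun r => Metric.isOpen_ball.measurableSet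
  have := unif_prob ha ha1
  have := unif_prob h0 h1
  have hμ : ∀ᵐ x ∂(unif m (Metric.ball x₀ ε)), dist x x₀ < ε := unif_ae (mball ε)
  have hξ : ∀ᵐ x ∂(unif m A), dist x x₀ < R := (unif_ae hA).mono fun x hx => hAR hx
  obtain ⟨μ, hμ0, hμ1, hgeo, hent⟩ := hCD _ _ (memP2_of_bounded hμ) (memP2_of_bounded hξ)
  have hR0 : 0 < R := by linarith
  obtain ⟨t, ht⟩ : ∃ t, t = ε / R := ⟨_, rfl⟩
  have htR : t * R = ε := by rw [ht]; field_simp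
  have ht0 : 0 < t := by rw [ht]; positivity
  have ht1 : t ≤ 1/2 := by nlinarith
  have htI : t ∈ Icc (0:ℝ) 1 := ⟨ht0.le, by linarith⟩
  have hWle := Wsq_le_of_bounded hε hR0 hμ hξ
  have hWt : Wsq (unif m (Metric.ball x₀ ε)) (unif m A) ≠ ∞ :=
    ne_top_of_le_ne_top ENNReal.ofReal_ne_top hWle
  have g1 := hgeo 0 (by simp) t htI
  have g2 := hgeo t htI 1 (by simp)
  rw [show |0 - t| = t by rw [zero_sub, abs_neg, abs_of_pos ht0], hμ0, hμ1] at g1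
  rw [show |t - 1| = 1 - t by rw [abs_of_nonpos (by linarith)]; ring, hμ0, hμ1] at g2
  have w1 := Wsq_of_geodesic ht0.le g1
  have w2 := Wsq_of_geodesic (by linarith) g2
  have hconc := concentration hε hε2 hR ht hμ hξ hWt w1 w2
  have : IsProbabilityMeasure (μ t) := by
    have : Wsq (unif m (Metric.ball x₀ ε)) (μ t) < ∞ := by
      rw [w1]; exact ENNReal.mul_lt_top ENNReal.ofReal_lt_top hWt.lt_top
    obtain ⟨q, hq, -⟩ := exists_coupling_lt this
    exact coupling_prob_right hq
  have hlow := ent_lower (m := m) (mball (3*ε)) hb0 hb hconc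
  have h := hlow.trans (hent t htI)
  rw [unif_ent (mball ε) ha ha1, unif_ent hA h0 h1] at h
  obtain ⟨W, hW0, hW⟩ : ∃ W : ℝ, 0 ≤ W ∧
      Wsq (unif m (Metric.ball x₀ ε)) (unif m A) = ENNReal.ofReal W :=
    ⟨_, ENNReal.toReal_nonneg, (ENNReal.ofReal_toReal hWt).symm⟩
  rw [hW, ENNReal.ofReal_le_ofReal_iff (by positivity)] at hWle
  rw [hW, EReal.coe_ennreal_ofReal, max_eq_left hW0] at h
  norm_cast at h
  set la := Real.log (m (Metric.ball x₀ ε)).toReal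
  set lb := Real.log (m (Metric.ball x₀ (3*ε))).toReal
  set lA := Real.log (m A).toReal
  set k := max (-K) 0 with hk
  have hk0 : 0 ≤ k := le_max_right _ _
  have hkK : -K ≤ k := le_max_left _ _
  have hKW : -(K / 2 * (t * (1 - t)) * W) ≤ t * (k / 2 * (R+ε)^2) := by
    have s1 : -K * W ≤ k * (R+ε)^2 :=
      (mul_le_mul_of_nonneg_right hkK hW0).trans (mul_le_mul_of_nonneg_left hWle hk0)
    have s2 : 0 ≤ k * (R+ε)^2 := by positivity
    have s3 : (t * (1-t)) * (-K * W) ≤ (t * (1-t)) * (k * (R+ε)^2) :=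
      mul_le_mul_of_nonneg_left s1 (mul_nonneg ht0.le (by linarith))
    nlinarith [mul_nonneg (mul_nonneg ht0.le ht0.le) s2]
  have h2 : t * lA ≤ lb - la + t * la + t * (k / 2 * (R+ε)^2) := by
    linarith
  have h3 : lb - la = t * ((lb - la) / ε * R) := by
    rw [← htR]; field_simp
  have h4 : t * lA ≤ t * ((lb - la) / ε * R + la + k/2 * (R+ε)^2) := by
    linarith
  have h5 := le_of_mul_le_mul_left h4 ht0
  linarith

/-- **Volume growth under CD(K,∞):** `m(B_R(x₀)) ≤ exp((K⁻/2) R² + c₁ R + c₀)`. -/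
theorem volume_growth_CDinfty
    {X : Type*} [MetricSpace X] [CompleteSpace X] [TopologicalSpace.SeparableSpace X]
    [MeasurableSpace X] [BorelSpace X] (m : Measure X) [IsLocallyFiniteMeasure m]
    (K : ℝ) (hCD : CDinfty K m) (x₀ : X) (hx₀ : x₀ ∈ mmSupp m) :
    ∃ c₀ c₁ : ℝ, ∀ R : ℝ, 1 ≤ R →
      m (Metric.ball x₀ R) ≤
        ENNReal.ofReal (Real.exp (max (-K) 0 / 2 * R ^ 2 + c₁ * R + c₀)) := by
  have : SecondCountableTopology X := UniformSpace.secondCountable_of_separable X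
  obtain ⟨r, hr0, hr⟩ : ∃ r > 0, m (Metric.ball x₀ r) ≠ ∞ := by
    obtain ⟨s, hs, hs'⟩ := m.exists_isOpen_measure_lt_top x₀ |>.imp fun s hs => (⟨hs.2.1.mem_nhds hs.1, hs.2.2⟩ : s ∈ 𝓝 x₀ ∧ m s < ∞)
    obtain ⟨r, hr0, hr⟩ := Metric.mem_nhds_iff.1 hs
    exact ⟨r, hr0, (lt_of_le_of_lt (measure_mono hr) hs').ne⟩
  set ε := min (r/3) (1/2) with hε
  have hε0 : 0 < ε := by positivity
  have hε2 : ε ≤ 1/2 := min_le_right _ _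
  have hb : m (Metric.ball x₀ (3*ε)) ≠ ∞ :=
    ne_top_of_le_ne_top hr (measure_mono (Metric.ball_subset_ball (by
      have := min_le_left (r/3) (1/2); linarith)))
  have ha : m (Metric.ball x₀ ε) ≠ 0 := (hx₀ _ (Metric.ball_mem_nhds x₀ hε0)).ne'
  refine ⟨Real.log (m (Metric.ball x₀ ε)).toReal + max (-K) 0 / 2 * ε^2,
    (Real.log (m (Metric.ball x₀ (3*ε))).toReal - Real.log (m (Metric.ball x₀ ε)).toReal) / ε
      + max (-K) 0 * ε, fun R hR => le_of_forall_lt fun c hc => ?_⟩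
  · obtain ⟨A, hA, hAR, hcA, hAt⟩ :=
      Measure.exists_subset_measure_lt_top Metric.isOpen_ball.measurableSet hc
    refine hcA.trans_le ?_
    have h0 : m A ≠ 0 := (zero_le.trans_lt hcA).ne'
    have := finite_set_bound m K hCD x₀ hε0 hε2 hR ha hb hA hAR h0 hAt.ne
    rw [Real.log_le_iff_le_exp (ENNReal.toReal_pos h0 hAt.ne)] at this
    rw [← ENNReal.ofReal_toReal hAt.ne]
    exact ENNReal.ofReal_le_ofReal this

end
end

section
/- Let κ > 0 and consider the mm-space (ℝ, |·|, m) where dm(x) = exp(κx²/2) dx. Then (i) this mm-space satisfies CD(−κ,∞), and (ii) m(B_R(x)) ≥ exp( (κ/2)·(R−1/2)² ) for every x ∈ ℝ and every R ≥ 1/2, where B_R(x) is the open ball of radius R around x. -/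
open MeasureTheory Filter Set Topology ENNReal
open scoped Classical

noncomputable section

abbrev lam : Measure ℝ := (volume : Measure ℝ).restrict (Ioo 0 1)

abbrev gm (κ : ℝ) : Measure ℝ :=
  (volume : Measure ℝ).withDensity fun x => ENNReal.ofReal (Real.exp (κ * x ^ 2 / 2))

instance lam_prob : IsProbabilityMeasure lam := ⟨by simp [lam]⟩

lemma exists_quantile (μ : Measure ℝ) [IsProbabilityMeasure μ] :
    ∃ Q : ℝ → ℝ, Measurable Q ∧ MonotoneOn Q (Ioo 0 1) ∧ Measure.map Q lam = μ := by
  set F := ProbabilityTheory.cdf μ with hF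
  let Q : ℝ → ℝ := fun u => if u ∈ Ioo (0:ℝ) 1 then sInf {x | u ≤ F x} else 0
  have gal : ∀ u ∈ Ioo (0:ℝ) 1, ∀ x, Q u ≤ x ↔ u ≤ F x := by
    intro u hu x
    have hQ : Q u = sInf {x | u ≤ F x} := if_pos hu
    have hne : {x | u ≤ F x}.Nonempty := by
      obtain ⟨y, hy⟩ := ((ProbabilityTheory.tendsto_cdf_atTop μ).eventually
        (lt_mem_nhds hu.2)).exists
      exact ⟨y, hy.le⟩
    have hbdd : BddBelow {x | u ≤ F x} := by
      obtain ⟨y, hy⟩ := ((ProbabilityTheory.tendsto_cdf_atBot μ).eventually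
        (gt_mem_nhds hu.1)).exists
      refine ⟨y, fun z hz => ?_⟩
      by_contra hlt
      push Not at hlt
      exact absurd (lt_of_le_of_lt hz (lt_of_le_of_lt (F.mono hlt.le) hy)) (lt_irrefl _)
    constructor
    · intro h
      rw [hQ] at h
      have hall : ∀ y, x < y → u ≤ F y := by
        intro y hy
        obtain ⟨z, hz, hzy⟩ := (csInf_lt_iff hbdd hne).1 (lt_of_le_of_lt h hy)
        exact le_trans hz (F.mono hzy.le)
      have hc : Tendsto F (𝓝[>] x) (𝓝 (F x)) :=
        (F.right_continuous x).tendsto.mono_left (nhdsWithin_mono _ Ioi_subset_Ici_self)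
      exact ge_of_tendsto hc (by filter_upwards [self_mem_nhdsWithin] with y hy using hall y hy)
    · intro h
      rw [hQ]
      exact csInf_le hbdd h
  have hmono : MonotoneOn Q (Ioo 0 1) := by
    intro a ha b hb hab
    rw [gal a ha]
    exact hab.trans ((gal b hb _).1 le_rfl)
  have hmeas : Measurable Q := by
    refine measurable_of_Iic fun x => ?_
    have : Q ⁻¹' Iic x = (Ioo 0 1 ∩ Iic (F x)) ∪ ((Ioo (0:ℝ) 1)ᶜ ∩ {_u | (0:ℝ) ≤ x}) := by
      ext u
      by_cases hu : u ∈ Ioo (0:ℝ) 1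
      · have := gal u hu x
        simp only [mem_preimage, mem_Iic, mem_union, mem_inter_iff, hu, mem_compl_iff, this]
        simp
      · have : Q u = 0 := if_neg hu
        simp only [mem_preimage, mem_Iic, mem_union, mem_inter_iff, hu, mem_compl_iff, this]
        simp
    rw [this]
    exact (measurableSet_Ioo.inter measurableSet_Iic).union
      (measurableSet_Ioo.compl.inter (MeasurableSet.const _))
  refine ⟨Q, hmeas, hmono, ?_⟩
  have : IsProbabilityMeasure (Measure.map Q lam) :=
    Measure.isProbabilityMeasure_map hmeas.aemeasurable
  refine Measure.ext_of_Iic _ _ fun x => ?_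
  rw [Measure.map_apply hmeas measurableSet_Iic, Measure.restrict_apply (hmeas measurableSet_Iic)]
  have h1 : Q ⁻¹' Iic x ∩ Ioo 0 1 = Ioo 0 1 ∩ Iic (F x) := by
    ext u
    constructor
    · rintro ⟨h, hu⟩; exact ⟨hu, (gal u hu x).1 h⟩
    · rintro ⟨hu, h⟩; exact ⟨(gal u hu x).2 h, hu⟩
  rw [h1, ← ProbabilityTheory.ofReal_cdf μ x]
  have h0 : 0 ≤ F x := ProbabilityTheory.cdf_nonneg μ x
  have h2 : F x ≤ 1 := ProbabilityTheory.cdf_le_one μ x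
  apply le_antisymm
  · calc volume (Ioo 0 1 ∩ Iic (F x)) ≤ volume (Ioc 0 (F x)) :=
        measure_mono fun u hu => ⟨hu.1.1, hu.2⟩
      _ = _ := by rw [Real.volume_Ioc, sub_zero]
  · calc ENNReal.ofReal (F x) = volume (Ioo 0 (F x)) := by rw [Real.volume_Ioo, sub_zero]
      _ ≤ volume (Ioo 0 1 ∩ Iic (F x)) :=
        measure_mono fun u hu => ⟨⟨hu.1, hu.2.trans_le h2⟩, hu.2.le⟩

/-- The set of pairs used in the layer-cake representation of the quadratic cost. -/
def layer (p : ℝ × ℝ) : Set (ℝ × ℝ) := {z | z.2 ≤ min p.1 p.2 ∧ max p.1 p.2 < z.1}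
def layer' (p : ℝ × ℝ) : Set (ℝ × ℝ) := {z | z.1 ≤ min p.1 p.2 ∧ max p.1 p.2 < z.2}

lemma sq_layer (x y : ℝ) :
    volume {p : ℝ × ℝ | y ≤ min p.1 p.2 ∧ max p.1 p.2 < x} = ENNReal.ofReal (x - y) ^ 2 := by
  have : {p : ℝ × ℝ | y ≤ min p.1 p.2 ∧ max p.1 p.2 < x} = Ico y x ×ˢ Ico y x := by
    ext p; simp only [mem_ofPred_eq, le_min_iff, max_lt_iff, mem_prod, mem_Ico]; tauto
  rw [this, Measure.volume_eq_prod, Measure.prod_prod, Real.volume_Ico, sq]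

lemma edist_sq_layer (x y : ℝ) :
    edist x y ^ 2 = ENNReal.ofReal (x - y) ^ 2 + ENNReal.ofReal (y - x) ^ 2 := by
  rw [edist_dist, Real.dist_eq]
  rcases le_total x y with h | h
  · rw [ENNReal.ofReal_of_nonpos (sub_nonpos.2 h), abs_of_nonpos (sub_nonpos.2 h)]; simp
  · rw [ENNReal.ofReal_of_nonpos (sub_nonpos.2 h), abs_of_nonneg (sub_nonneg.2 h)]; simp

lemma layer_tonelli (q : Measure (ℝ × ℝ)) [SFinite q] :
    ∫⁻ z, ENNReal.ofReal (z.1 - z.2) ^ 2 ∂q = ∫⁻ p : ℝ × ℝ, q (layer p) := by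
  have hm : MeasurableSet {w : (ℝ × ℝ) × (ℝ × ℝ) |
      w.1.2 ≤ min w.2.1 w.2.2 ∧ max w.2.1 w.2.2 < w.1.1} := by
    have e1 : MeasurableSet {w : (ℝ × ℝ) × (ℝ × ℝ) | w.1.2 ≤ min w.2.1 w.2.2} :=
      measurableSet_le (by fun_prop) (by fun_prop)
    have e2 : MeasurableSet {w : (ℝ × ℝ) × (ℝ × ℝ) | max w.2.1 w.2.2 < w.1.1} :=
      measurableSet_lt (by fun_prop) (by fun_prop)
    convert e1.inter e2 using 1
    ext w; exact Iff.rfl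
  have h1 := Measure.prod_apply (μ := q) (ν := (volume : Measure (ℝ × ℝ))) hm
  have h2 := Measure.prod_apply_symm (μ := q) (ν := (volume : Measure (ℝ × ℝ))) hm
  rw [h1] at h2
  simp_rw [← sq_layer]
  exact h2

lemma layer_tonelli' (q : Measure (ℝ × ℝ)) [SFinite q] :
    ∫⁻ z, ENNReal.ofReal (z.2 - z.1) ^ 2 ∂q = ∫⁻ p : ℝ × ℝ, q (layer' p) := by
  have hm : MeasurableSet {w : (ℝ × ℝ) × (ℝ × ℝ) |
      w.1.1 ≤ min w.2.1 w.2.2 ∧ max w.2.1 w.2.2 < w.1.2} := by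
    have e1 : MeasurableSet {w : (ℝ × ℝ) × (ℝ × ℝ) | w.1.1 ≤ min w.2.1 w.2.2} :=
      measurableSet_le (by fun_prop) (by fun_prop)
    have e2 : MeasurableSet {w : (ℝ × ℝ) × (ℝ × ℝ) | max w.2.1 w.2.2 < w.1.2} :=
      measurableSet_lt (by fun_prop) (by fun_prop)
    convert e1.inter e2 using 1
    ext w; exact Iff.rfl
  have h1 := Measure.prod_apply (μ := q) (ν := (volume : Measure (ℝ × ℝ))) hm
  have h2 := Measure.prod_apply_symm (μ := q) (ν := (volume : Measure (ℝ × ℝ))) hm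
  rw [h1] at h2
  simp_rw [← sq_layer]
  exact h2

lemma layer_meas_mono {f g : ℝ → ℝ} (hf : Measurable f) (hg : Measurable g)
    (mf : MonotoneOn f (Ioo 0 1)) (mg : MonotoneOn g (Ioo 0 1)) (a b : ℝ) :
    lam {u | g u ≤ a ∧ b < f u} ≤ Measure.map g lam (Iic a) - Measure.map f lam (Iic b) := by
  rw [Measure.map_apply hg measurableSet_Iic, Measure.map_apply hf measurableSet_Iic]
  have e : {u | g u ≤ a ∧ b < f u} = (g ⁻¹' Iic a) \ (f ⁻¹' Iic b) := by
    ext u; simp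
  by_cases h : ∃ u ∈ Ioo (0:ℝ) 1, g u ≤ a ∧ b < f u
  · obtain ⟨u, hu, h1, h2⟩ := h
    rw [e]
    refine ENNReal.le_sub_of_add_le_right (measure_ne_top _ _) ?_
    rw [← measure_union disjoint_sdiff_left (hf measurableSet_Iic)]
    refine measure_mono_ae ?_
    filter_upwards [ae_restrict_mem measurableSet_Ioo] with v hv hvs
    rcases hvs with hvs | hvs
    · exact hvs.1
    · have hvu : v ≤ u := by
        by_contra hlt
        push Not at hlt
        exact absurd (lt_of_le_of_lt (le_trans (mf hu hv hlt.le) hvs) h2) (lt_irrefl _)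
      exact le_trans (mg hv hu hvu) h1
  · have : lam {u | g u ≤ a ∧ b < f u} = 0 := by
      rw [Measure.restrict_apply' measurableSet_Ioo]
      convert measure_empty (μ := (volume : Measure ℝ))
      ext u
      simp only [mem_inter_iff, mem_ofPred_eq, mem_empty_iff_false, iff_false]
      exact fun hh => h ⟨u, hh.2, hh.1⟩
    rw [this]; exact zero_le


lemma wsq_mono {f g : ℝ → ℝ} (hf : Measurable f) (hg : Measurable g)
    (mf : MonotoneOn f (Ioo 0 1)) (mg : MonotoneOn g (Ioo 0 1)) :
    Wsq (Measure.map f lam) (Measure.map g lam) = ∫⁻ u, edist (f u) (g u) ^ 2 ∂lam := by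
  have hfg : Measurable fun u => (f u, g u) := hf.prodMk hg
  have hpf : IsProbabilityMeasure (Measure.map f lam) :=
    Measure.isProbabilityMeasure_map hf.aemeasurable
  have hdec : ∀ q : Measure (ℝ × ℝ), SFinite q →
      ∫⁻ z, edist z.1 z.2 ^ 2 ∂q = (∫⁻ p, q (layer p)) + ∫⁻ p, q (layer' p) := by
    intro q hq
    simp_rw [edist_sq_layer]
    rw [lintegral_add_left (by fun_prop), layer_tonelli, layer_tonelli']
  have hq0 : ∫⁻ u, edist (f u) (g u) ^ 2 ∂lam =
      ∫⁻ z, edist z.1 z.2 ^ 2 ∂(Measure.map (fun u => (f u, g u)) lam) := by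
    rw [lintegral_map (by fun_prop) hfg]
  have ml : ∀ p, MeasurableSet (layer p) := by
    intro p
    have e1 : MeasurableSet {w : (ℝ × ℝ) | w.2 ≤ min p.1 p.2} :=
      measurableSet_le (by fun_prop) (by fun_prop)
    have e2 : MeasurableSet {w : (ℝ × ℝ) | max p.1 p.2 < w.1} :=
      measurableSet_lt (by fun_prop) (by fun_prop)
    convert e1.inter e2 using 1
    ext w; exact Iff.rfl
  have ml' : ∀ p, MeasurableSet (layer' p) := by
    intro p
    have e1 : MeasurableSet {w : (ℝ × ℝ) | w.1 ≤ min p.1 p.2} :=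
      measurableSet_le (by fun_prop) (by fun_prop)
    have e2 : MeasurableSet {w : (ℝ × ℝ) | max p.1 p.2 < w.2} :=
      measurableSet_lt (by fun_prop) (by fun_prop)
    convert e1.inter e2 using 1
    ext w; exact Iff.rfl
  apply le_antisymm
  · unfold Wsq
    refine iInf₂_le_of_le (Measure.map (fun u => (f u, g u)) lam) ⟨?_, ?_⟩ hq0.ge
    · rw [Measure.map_map measurable_fst hfg]; rfl
    · rw [Measure.map_map measurable_snd hfg]; rfl
  · unfold Wsq
    refine le_iInf₂ fun q hq => ?_
    have hqf : IsFiniteMeasure q := by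
      refine ⟨?_⟩
      have : Measure.map Prod.fst q univ = 1 := by rw [hq.1]; simp
      rw [Measure.map_apply measurable_fst MeasurableSet.univ, preimage_univ] at this
      rw [this]; simp
    rw [hq0, hdec _ inferInstance, hdec q inferInstance]
    have k1 : ∀ a, Measure.map f lam (Iic a) = q (Prod.fst ⁻¹' Iic a) := fun a => by
      rw [← hq.1, Measure.map_apply measurable_fst measurableSet_Iic]
    have k2 : ∀ a, Measure.map g lam (Iic a) = q (Prod.snd ⁻¹' Iic a) := fun a => by
      rw [← hq.2, Measure.map_apply measurable_snd measurableSet_Iic]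
    refine add_le_add (lintegral_mono fun p => ?_) (lintegral_mono fun p => ?_)
    · rw [Measure.map_apply hfg (ml p)]
      refine (layer_meas_mono hf hg mf mg (min p.1 p.2) (max p.1 p.2)).trans ?_
      rw [k1, k2]
      refine le_measure_sdiff.trans (measure_mono fun z hz => ?_)
      exact ⟨hz.1, not_le.1 hz.2⟩
    · rw [Measure.map_apply hfg (ml' p)]
      refine (layer_meas_mono hg hf mg mf (min p.1 p.2) (max p.1 p.2)).trans ?_
      rw [k1, k2]
      refine le_measure_sdiff.trans (measure_mono fun z hz => ?_)
      exact ⟨hz.1, not_le.1 hz.2⟩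

def Qt (Q₀ Q₁ : ℝ → ℝ) (t : ℝ) : ℝ → ℝ := fun u => (1 - t) * Q₀ u + t * Q₁ u

lemma Qt_meas {f g : ℝ → ℝ} (hf : Measurable f) (hg : Measurable g) (t : ℝ) :
    Measurable (Qt f g t) := by unfold Qt; fun_prop

lemma Qt_mono {f g : ℝ → ℝ} 
    (mf : MonotoneOn f (Ioo 0 1)) (mg : MonotoneOn g (Ioo 0 1)) {t : ℝ} (ht : t ∈ Icc (0:ℝ) 1) :
    MonotoneOn (Qt f g t) (Ioo 0 1) := by
  intro a ha b hb hab
  exact add_le_add (mul_le_mul_of_nonneg_left (mf ha hb hab) (sub_nonneg.2 ht.2))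
    (mul_le_mul_of_nonneg_left (mg ha hb hab) ht.1)

lemma Qt_geodesic {f g : ℝ → ℝ} (hf : Measurable f) (hg : Measurable g)
    (mf : MonotoneOn f (Ioo 0 1)) (mg : MonotoneOn g (Ioo 0 1)) :
    IsW2Geodesic (fun t => Measure.map (Qt f g t) lam) := by
  have key : ∀ s ∈ Icc (0:ℝ) 1, ∀ t ∈ Icc (0:ℝ) 1,
      Wsq (Measure.map (Qt f g s) lam) (Measure.map (Qt f g t) lam) =
        ENNReal.ofReal |s - t| ^ 2 * ∫⁻ u, edist (f u) (g u) ^ 2 ∂lam := by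
    intro s hs t ht
    rw [wsq_mono (Qt_meas hf hg s) (Qt_meas hf hg t) (Qt_mono mf mg hs) (Qt_mono mf mg ht),
      ← lintegral_const_mul _ (by fun_prop)]
    refine lintegral_congr fun u => ?_
    rw [← mul_pow, edist_dist, edist_dist, ← ENNReal.ofReal_mul (abs_nonneg _), Real.dist_eq,
      Real.dist_eq, ← abs_mul, ← abs_neg]
    congr 3
    unfold Qt
    ring
  intro s hs t ht
  have h01 := key 0 (by simp) 1 (by simp)
  simp only [W2]
  rw [key s hs t ht, h01, ENNReal.mul_rpow_of_nonneg _ _ (by norm_num)]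
  congr 1
  · rw [← ENNReal.rpow_natCast, ← ENNReal.rpow_mul]; norm_num
  · simp

/-- Points of `(0,1)` where `Q` is differentiable. -/
def dset (Q : ℝ → ℝ) : Set ℝ := Ioo 0 1 ∩ {u | DifferentiableAt ℝ Q u}

lemma dset_meas (Q : ℝ → ℝ) : MeasurableSet (dset Q) :=
  measurableSet_Ioo.inter (measurableSet_of_differentiableAt ℝ Q)

lemma dset_ae {Q : ℝ → ℝ} (hQ : MonotoneOn Q (Ioo 0 1)) : ∀ᵐ u ∂lam, u ∈ dset Q := by
  filter_upwards [hQ.ae_differentiableWithinAt measurableSet_Ioo,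
    ae_restrict_mem measurableSet_Ioo] with u hu hu'
  exact ⟨hu', hu.differentiableAt (isOpen_Ioo.mem_nhds hu')⟩

lemma deriv_nonneg_dset {Q : ℝ → ℝ} (hQ : MonotoneOn Q (Ioo 0 1)) {u : ℝ} (hu : u ∈ Ioo (0:ℝ) 1) :
    0 ≤ deriv Q u := by
  rw [← derivWithin_of_isOpen isOpen_Ioo hu]
  exact hQ.derivWithin_nonneg

lemma chvar {Q : ℝ → ℝ} (hQ : StrictMonoOn Q (Ioo 0 1)) {B : Set ℝ} (hB : MeasurableSet B)
    (hBs : B ⊆ dset Q) (g : ℝ → ℝ≥0∞) :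
    ∫⁻ x in Q '' B, g x = ∫⁻ u in B, ENNReal.ofReal (deriv Q u) * g (Q u) := by
  rw [lintegral_image_eq_lintegral_abs_deriv_mul hB (f' := deriv Q)
    (fun x hx => (hBs hx).2.hasDerivAt.hasDerivWithinAt)
    (hQ.injOn.mono (fun x hx => (hBs hx).1))]
  refine setLIntegral_congr_fun hB fun u hu => ?_
  rw [abs_of_nonneg (deriv_nonneg_dset hQ.monotoneOn (hBs hu).1)]

lemma vol_ac_gm (κ : ℝ) : (volume : Measure ℝ) ≪ gm κ := by
  refine withDensity_absolutelyContinuous' (by fun_prop) ?_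
  filter_upwards with x
  simp [Real.exp_pos]

lemma gm_ac_vol (κ : ℝ) : gm κ ≪ (volume : Measure ℝ) := withDensity_absolutelyContinuous _ _

lemma map_ac {Q : ℝ → ℝ} (hm : Measurable Q) (hQ : StrictMonoOn Q (Ioo 0 1))
    (hpos : ∀ᵐ u ∂lam, 0 < deriv Q u) : Measure.map Q lam ≪ (volume : Measure ℝ) := by
  refine Measure.AbsolutelyContinuous.mk fun A hA h0 => ?_
  rw [Measure.map_apply hm hA]
  have hB : MeasurableSet (Q ⁻¹' A ∩ dset Q) := (hm hA).inter (dset_meas Q)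
  have h1 := chvar hQ hB inter_subset_right (fun _ => 1)
  have h2 : volume (Q '' (Q ⁻¹' A ∩ dset Q)) = 0 :=
    measure_mono_null (by rintro _ ⟨u, hu, rfl⟩; exact hu.1) h0
  rw [setLIntegral_one, h2] at h1
  have h3 := (lintegral_eq_zero_iff (by fun_prop)).1 h1.symm
  rw [Filter.EventuallyEq, ae_restrict_iff' hB] at h3
  have h4 : ∀ᵐ u ∂lam, u ∉ Q ⁻¹' A := by
    filter_upwards [ae_restrict_of_ae h3, hpos, dset_ae hQ.monotoneOn] with u a b c d
    have := a ⟨d, c⟩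
    simp at this
    linarith
  exact measure_eq_zero_iff_ae_notMem.2 h4

lemma jac {κ : ℝ} {Q : ℝ → ℝ} (hm : Measurable Q) (hQ : StrictMonoOn Q (Ioo 0 1))
    (hac : Measure.map Q lam ≪ gm κ) :
    ∀ᵐ u ∂lam, ENNReal.ofReal (deriv Q u) * (ENNReal.ofReal (Real.exp (κ * Q u ^ 2 / 2)) *
      (Measure.map Q lam).rnDeriv (gm κ) (Q u)) = 1 := by
  have hρ := Measure.measurable_rnDeriv (Measure.map Q lam) (gm κ)
  have := ae_eq_of_forall_setLIntegral_eq_of_sigmaFinite (μ := lam)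
    (f := fun u => ENNReal.ofReal (deriv Q u) * (ENNReal.ofReal (Real.exp (κ * Q u ^ 2 / 2)) *
      (Measure.map Q lam).rnDeriv (gm κ) (Q u))) (g := fun _ => 1) (by fun_prop) (by fun_prop) ?_
  · exact this
  intro B hB _
  have hB' : MeasurableSet (B ∩ dset Q) := hB.inter (dset_meas Q)
  have hsub : dset Q ⊆ Ioo 0 1 := inter_subset_left
  have e0 : lam.restrict B = volume.restrict (B ∩ dset Q) := by
    rw [Measure.restrict_restrict hB]
    refine Measure.restrict_congr_set ?_
    have := dset_ae hQ.monotoneOn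
    rw [ae_restrict_iff' measurableSet_Ioo] at this
    filter_upwards [this] with u hu
    apply propext
    exact ⟨fun h => ⟨h.1, hu h.2⟩, fun h => ⟨h.1, hsub h.2⟩⟩
  have hinj : InjOn Q (B ∩ dset Q) := hQ.injOn.mono (fun x hx => hsub hx.2)
  have hI : MeasurableSet (Q '' (B ∩ dset Q)) := hB'.image_of_measurable_injOn hm hinj
  rw [e0, ← chvar hQ hB' inter_subset_right (fun x => ENNReal.ofReal (Real.exp (κ * x ^ 2 / 2)) *
      (Measure.map Q lam).rnDeriv (gm κ) x)]
  have e1 := setLIntegral_withDensity_eq_setLIntegral_mul (volume : Measure ℝ)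
    (f := fun x => ENNReal.ofReal (Real.exp (κ * x ^ 2 / 2))) (by fun_prop) hρ hI
  simp only [Pi.mul_apply] at e1
  rw [← e1, Measure.setLIntegral_rnDeriv hac, Measure.map_apply hm hI, setLIntegral_one,
    Measure.restrict_apply (hm hI)]
  congr 1
  ext u
  constructor
  · rintro ⟨⟨v, hv, hvu⟩, hu⟩
    rwa [← hQ.injOn (hsub hv.2) hu hvu]
  · exact fun hu => ⟨⟨u, hu, rfl⟩, hsub hu.2⟩

/-- Logarithmic density along the quantile function. -/
def Lf (κ : ℝ) (Q : ℝ → ℝ) (u : ℝ) : ℝ := -Real.log (deriv Q u) - κ * Q u ^ 2 / 2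

lemma Lf_meas (κ : ℝ) {Q : ℝ → ℝ} (hm : Measurable Q) : Measurable (Lf κ Q) := by
  unfold Lf; fun_prop

lemma log_dens {κ : ℝ} {Q : ℝ → ℝ} (hm : Measurable Q) (hQ : StrictMonoOn Q (Ioo 0 1))
    (hac : Measure.map Q lam ≪ gm κ) :
    ∀ᵐ u ∂lam, 0 < deriv Q u ∧
      Real.log ((Measure.map Q lam).rnDeriv (gm κ) (Q u)).toReal = Lf κ Q u := by
  filter_upwards [jac hm hQ hac] with u hu
  have hd : 0 < deriv Q u := by
    by_contra h
    rw [ENNReal.ofReal_of_nonpos (not_lt.1 h)] at hu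
    simp at hu
  refine ⟨hd, ?_⟩
  have h := congrArg ENNReal.toReal hu
  rw [ENNReal.toReal_mul, ENNReal.toReal_mul, ENNReal.toReal_ofReal hd.le,
    ENNReal.toReal_ofReal (Real.exp_pos _).le, ENNReal.toReal_one] at h
  have hr : ((Measure.map Q lam).rnDeriv (gm κ) (Q u)).toReal ≠ 0 := by
    intro h0; rw [h0] at h; simp at h
  have h' := congrArg Real.log h
  rw [Real.log_mul hd.ne' (mul_ne_zero (Real.exp_pos _).ne' hr),
    Real.log_mul (Real.exp_pos _).ne' hr, Real.log_exp, Real.log_one] at h'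
  unfold Lf
  linarith

lemma ent_formula {κ : ℝ} {Q : ℝ → ℝ} (hm : Measurable Q) (hQ : StrictMonoOn Q (Ioo 0 1))
    (hac : Measure.map Q lam ≪ gm κ) :
    (Integrable (fun x => max (entFun (Measure.map Q lam) (gm κ) x) 0) (gm κ) ↔
      Integrable (fun u => max (Lf κ Q u) 0) lam) ∧
    ∫ x, max (entFun (Measure.map Q lam) (gm κ) x) 0 ∂(gm κ) = ∫ u, max (Lf κ Q u) 0 ∂lam ∧
    ∫⁻ x, ENNReal.ofReal (-(entFun (Measure.map Q lam) (gm κ) x)) ∂(gm κ)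
      = ∫⁻ u, ENNReal.ofReal (- Lf κ Q u) ∂lam := by
  set μ := Measure.map Q lam with hμ
  have hμp : IsProbabilityMeasure μ := Measure.isProbabilityMeasure_map hm.aemeasurable
  have hρ := Measure.measurable_rnDeriv μ (gm κ)
  have hl := log_dens hm hQ hac
  have e1 : (fun x => max (entFun μ (gm κ) x) 0) = fun x => (μ.rnDeriv (gm κ) x).toReal *
      max (Real.log (μ.rnDeriv (gm κ) x).toReal) 0 := by
    ext x
    rw [entFun, mul_max_of_nonneg _ _ ENNReal.toReal_nonneg, mul_zero]
  have hmm : Measurable fun x => max (Real.log (μ.rnDeriv (gm κ) x).toReal) 0 := by fun_prop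
  refine ⟨?_, ?_, ?_⟩
  · rw [e1, integrable_toReal_rnDeriv_mul_iff hac, hμ,
      integrable_map_measure hmm.aestronglyMeasurable hm.aemeasurable]
    refine integrable_congr ?_
    filter_upwards [hl] with u hu
    simp only [Function.comp]
    rw [← hu.2]
  · rw [e1, integral_toReal_rnDeriv_mul hac, hμ,
      integral_map hm.aemeasurable hmm.aestronglyMeasurable]
    refine integral_congr_ae ?_
    filter_upwards [hl] with u hu
    rw [← hu.2]
  · have e2 : ∀ᵐ x ∂(gm κ), ENNReal.ofReal (-(entFun μ (gm κ) x)) = μ.rnDeriv (gm κ) x *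
        ENNReal.ofReal (-Real.log (μ.rnDeriv (gm κ) x).toReal) := by
      filter_upwards [Measure.rnDeriv_lt_top μ (gm κ)] with x hx
      rw [entFun, ← mul_neg, ENNReal.ofReal_mul ENNReal.toReal_nonneg,
        ENNReal.ofReal_toReal hx.ne]
    rw [lintegral_congr_ae e2, lintegral_rnDeriv_mul hac (by fun_prop), hμ,
      lintegral_map (by fun_prop) hm]
    refine lintegral_congr_ae ?_
    filter_upwards [hl] with u hu
    rw [← hu.2]

lemma second_moment {μ : Measure ℝ} (h : MemP2 μ) : ∫⁻ x, ENNReal.ofReal (x ^ 2) ∂μ < ∞ := by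
  obtain ⟨hp, x₀, hx⟩ := h
  have : ∀ x : ℝ, ENNReal.ofReal (x ^ 2) ≤ 2 * edist x x₀ ^ 2 + ENNReal.ofReal (2 * x₀ ^ 2) := by
    intro x
    rw [edist_dist, Real.dist_eq, ← ENNReal.ofReal_pow (abs_nonneg _), sq_abs,
      show (2 : ℝ≥0∞) = ENNReal.ofReal 2 by simp, ← ENNReal.ofReal_mul (by norm_num),
      ← ENNReal.ofReal_add (by positivity) (by positivity)]
    refine ENNReal.ofReal_le_ofReal ?_
    nlinarith [sq_nonneg (x - 2 * x₀)]
  refine (lintegral_mono this).trans_lt ?_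
  rw [lintegral_add_right _ (by fun_prop), lintegral_const_mul _ (by fun_prop)]
  refine ENNReal.add_lt_top.2 ⟨ENNReal.mul_lt_top (by simp) hx, ?_⟩
  rw [lintegral_const, measure_univ, mul_one]
  exact ENNReal.ofReal_lt_top

lemma fenchel_log (r a : ℝ) (hr : 0 ≤ r) : -(r * Real.log r) ≤ r * a + Real.exp (-a) := by
  rcases hr.eq_or_lt with rfl | hr
  · simp [(Real.exp_pos _).le]
  have h := Real.log_le_sub_one_of_pos (div_pos (Real.exp_pos (-a)) hr)
  rw [Real.log_div (Real.exp_pos _).ne' hr.ne', Real.log_exp] at h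
  have h2 := mul_le_mul_of_nonneg_left h hr.le
  have h3 : r * (Real.exp (-a) / r - 1) = Real.exp (-a) - r := by field_simp
  rw [h3] at h2
  nlinarith

lemma neg_part_finite {κ : ℝ} (hκ : 0 < κ) {μ : Measure ℝ} (h : MemP2 μ) :
    ∫⁻ x, ENNReal.ofReal (-(entFun μ (gm κ) x)) ∂(gm κ) < ∞ := by
  have hp := h.1
  have hρ := Measure.measurable_rnDeriv μ (gm κ)
  have hle : ∫⁻ x, ENNReal.ofReal (-(entFun μ (gm κ) x)) ∂(gm κ) ≤
      ∫⁻ x, (μ.rnDeriv (gm κ) x * ENNReal.ofReal (κ * x ^ 2) +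
        ENNReal.ofReal (Real.exp (-(κ * x ^ 2)))) ∂(gm κ) := by
    refine lintegral_mono_ae ?_
    filter_upwards [Measure.rnDeriv_lt_top μ (gm κ)] with x hx
    rw [← ENNReal.ofReal_toReal hx.ne, ← ENNReal.ofReal_mul ENNReal.toReal_nonneg,
      ← ENNReal.ofReal_add (by positivity) (Real.exp_pos _).le]
    exact ENNReal.ofReal_le_ofReal (fenchel_log _ _ ENNReal.toReal_nonneg)
  refine hle.trans_lt ?_
  rw [lintegral_add_right _ (by fun_prop)]
  refine ENNReal.add_lt_top.2 ⟨?_, ?_⟩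
  · have e : ∫⁻ x, μ.rnDeriv (gm κ) x * ENNReal.ofReal (κ * x ^ 2) ∂(gm κ) ≤
        ∫⁻ x, ENNReal.ofReal (κ * x ^ 2) ∂μ := by
      have := lintegral_withDensity_eq_lintegral_mul (gm κ) hρ
        (g := fun x : ℝ => ENNReal.ofReal (κ * x ^ 2)) (by fun_prop)
      simp only [Pi.mul_apply] at this
      rw [← this]
      exact lintegral_mono' (Measure.withDensity_rnDeriv_le _ _) le_rfl
    refine e.trans_lt ?_
    simp_rw [ENNReal.ofReal_mul hκ.le]
    rw [lintegral_const_mul _ (by fun_prop)]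
    exact ENNReal.mul_lt_top (by simp) (second_moment h)
  · rw [lintegral_withDensity_eq_lintegral_mul _ (by fun_prop) (by fun_prop)]
    have hi := (integrable_exp_neg_mul_sq (half_pos hκ)).lintegral_lt_top
    refine lt_of_eq_of_lt (lintegral_congr fun x => ?_) hi
    rw [Pi.mul_apply, ← ENNReal.ofReal_mul (Real.exp_pos _).le, ← Real.exp_add]
    congr 2
    ring

lemma ent_real {κ : ℝ} {Q : ℝ → ℝ} (hm : Measurable Q) (hQ : StrictMonoOn Q (Ioo 0 1))
    (hac : Measure.map Q lam ≪ gm κ) (hi : Integrable (fun u => max (Lf κ Q u) 0) lam)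
    (hn : ∫⁻ u, ENNReal.ofReal (- Lf κ Q u) ∂lam < ∞) :
    Integrable (Lf κ Q) lam ∧
      Ent (Measure.map Q lam) (gm κ) = ((∫ u, Lf κ Q u ∂lam : ℝ) : EReal) := by
  obtain ⟨f1, f2, f3⟩ := ent_formula hm hQ hac
  have hL := Lf_meas κ hm
  have hin : Integrable (fun u => max (-Lf κ Q u) 0) lam := by
    refine ⟨by fun_prop, ?_⟩
    rw [hasFiniteIntegral_iff_ofReal (by filter_upwards with u using le_max_right _ _)]
    refine lt_of_eq_of_lt (lintegral_congr fun u => ?_) hn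
    rw [ENNReal.ofReal_max]; simp
  have hsub : Lf κ Q = fun u => max (Lf κ Q u) 0 - max (-Lf κ Q u) 0 := by
    ext u
    rcases le_total (Lf κ Q u) 0 with h | h
    · rw [max_eq_right h, max_eq_left (neg_nonneg.2 h)]; ring
    · rw [max_eq_left h, max_eq_right (neg_nonpos.2 h)]; ring
  have hLint : Integrable (Lf κ Q) lam := by rw [hsub]; exact hi.sub hin
  refine ⟨hLint, ?_⟩
  rw [Ent, if_pos ⟨hac, f1.2 hi⟩, f2, f3]
  have e : ∫⁻ u, ENNReal.ofReal (- Lf κ Q u) ∂lam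
      = ENNReal.ofReal (∫ u, max (-Lf κ Q u) 0 ∂lam) := by
    rw [ofReal_integral_eq_lintegral_ofReal hin
      (by filter_upwards with u using le_max_right _ _)]
    refine lintegral_congr fun u => ?_
    rw [ENNReal.ofReal_max]; simp
  have e2 : ∫ u, Lf κ Q u ∂lam = ∫ u, max (Lf κ Q u) 0 ∂lam - ∫ u, max (-Lf κ Q u) 0 ∂lam := by
    rw [← integral_sub hi hin]; exact integral_congr_ae (ae_of_all _ fun u => congrFun hsub u)
  have e3 : 0 ≤ ∫ u, max (-Lf κ Q u) 0 ∂lam := integral_nonneg fun u => le_max_right _ _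
  rw [e, e2, EReal.coe_sub, EReal.coe_ennreal_ofReal, max_eq_left e3]

lemma ent_le {κ : ℝ} {Q H : ℝ → ℝ} (hm : Measurable Q) (hQ : StrictMonoOn Q (Ioo 0 1))
    (hac : Measure.map Q lam ≪ gm κ) (hH : Integrable H lam) (hle : ∀ᵐ u ∂lam, Lf κ Q u ≤ H u) :
    Ent (Measure.map Q lam) (gm κ) ≤ ((∫ u, H u ∂lam : ℝ) : EReal) := by
  have hL := Lf_meas κ hm
  have hi : Integrable (fun u => max (Lf κ Q u) 0) lam := by
    refine hH.norm.mono' (by fun_prop) ?_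
    filter_upwards [hle] with u hu
    rw [Real.norm_of_nonneg (le_max_right _ _)]
    exact max_le (hu.trans (Real.le_norm_self _)) (norm_nonneg _)
  by_cases hn : ∫⁻ u, ENNReal.ofReal (- Lf κ Q u) ∂lam < ∞
  · obtain ⟨h1, h2⟩ := ent_real hm hQ hac hi hn
    rw [h2]
    exact EReal.coe_le_coe_iff.2 (integral_mono_ae h1 hH hle)
  · obtain ⟨f1, f2, f3⟩ := ent_formula hm hQ hac
    rw [Ent, if_pos ⟨hac, f1.2 hi⟩, f2, f3, not_lt_top_iff.1 hn]
    simp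

lemma strict_of_ac {κ : ℝ} {Q : ℝ → ℝ} (hm : Measurable Q) (hQ : MonotoneOn Q (Ioo 0 1))
    (hac : Measure.map Q lam ≪ gm κ) : StrictMonoOn Q (Ioo 0 1) := by
  intro a ha b hb hab
  refine lt_of_le_of_ne (hQ ha hb hab.le) fun heq => ?_
  have h0 : Measure.map Q lam {Q a} = 0 := (hac.trans (gm_ac_vol κ)) (by simp)
  rw [Measure.map_apply hm (measurableSet_singleton _),
    Measure.restrict_apply (hm (measurableSet_singleton _))] at h0
  have h1 : volume (Icc a b) = 0 := by
    refine measure_mono_null (fun v hv => ?_) h0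
    have hv' : v ∈ Ioo (0:ℝ) 1 := ⟨ha.1.trans_le hv.1, hv.2.trans_lt hb.2⟩
    refine ⟨?_, hv'⟩
    exact le_antisymm ((hQ hv' hb hv.2).trans heq.ge) (hQ ha hv' hv.1)
  rw [Real.volume_Icc, ENNReal.ofReal_eq_zero] at h1
  linarith

lemma ent_ne_bot {κ : ℝ} (hκ : 0 < κ) {μ : Measure ℝ} (h : MemP2 μ) : Ent μ (gm κ) ≠ ⊥ := by
  unfold Ent
  split_ifs with hc
  · lift (∫⁻ x, ENNReal.ofReal (-(entFun μ (gm κ) x)) ∂(gm κ)) to NNReal using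
      (neg_part_finite hκ h).ne with y
    exact EReal.coe_ne_bot (_ - (y : ℝ))
  · simp

lemma edist_sq_real (x y : ℝ) : edist x y ^ 2 = ENNReal.ofReal ((x - y) ^ 2) := by
  rw [edist_dist, Real.dist_eq, ← ENNReal.ofReal_pow (abs_nonneg _), sq_abs]

lemma sq_integrable {Q : ℝ → ℝ} (hm : Measurable Q) (h : MemP2 (Measure.map Q lam)) :
    Integrable (fun u => Q u ^ 2) lam := by
  refine ⟨by fun_prop, ?_⟩
  rw [hasFiniteIntegral_iff_ofReal (by filter_upwards with u using sq_nonneg _)]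
  have := second_moment h
  rwa [lintegral_map (by fun_prop) hm] at this

lemma cd_main {κ : ℝ} (hκ : 0 < κ) : CDinfty (-κ) (gm κ) := by
  intro μ₀ μ₁ h₀ h₁
  have hp0 := h₀.1
  have hp1 := h₁.1
  obtain ⟨Q₀, m₀, mono₀, rfl⟩ := exists_quantile μ₀
  obtain ⟨Q₁, m₁, mono₁, rfl⟩ := exists_quantile μ₁
  have z0 : Qt Q₀ Q₁ 0 = Q₀ := by ext u; simp [Qt]
  have z1 : Qt Q₀ Q₁ 1 = Q₁ := by ext u; simp [Qt]
  refine ⟨fun t => Measure.map (Qt Q₀ Q₁ t) lam, by simp only [z0], by simp only [z1],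
    Qt_geodesic m₀ m₁ mono₀ mono₁, ?_⟩
  have s₀ := sq_integrable m₀ h₀
  have s₁ := sq_integrable m₁ h₁
  have sd : Integrable (fun u => (Q₀ u - Q₁ u) ^ 2) lam := by
    refine ((s₀.add s₁).const_mul 2).mono' (by fun_prop) ?_
    filter_upwards with u
    rw [Real.norm_of_nonneg (sq_nonneg _)]
    simp only [Pi.add_apply]
    nlinarith [sq_nonneg (Q₀ u + Q₁ u)]
  have hW : ((Wsq (Measure.map Q₀ lam) (Measure.map Q₁ lam) : ℝ≥0∞) : EReal) =
      ((∫ u, (Q₀ u - Q₁ u) ^ 2 ∂lam : ℝ) : EReal) := by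
    rw [wsq_mono m₀ m₁ mono₀ mono₁]
    simp_rw [edist_sq_real]
    rw [← ofReal_integral_eq_lintegral_ofReal sd (by filter_upwards with u using sq_nonneg _),
      EReal.coe_ennreal_ofReal, max_eq_left (integral_nonneg fun u => sq_nonneg _)]
  intro t ht
  rw [hW]
  simp only
  rcases ht.1.eq_or_lt with rfl | ht0
  · rw [z0]; simp
  rcases ht.2.eq_or_lt with rfl | ht1
  · rw [z1]; simp
  have b0 := ent_ne_bot hκ h₀
  have b1 := ent_ne_bot hκ h₁
  have ht1' : 0 < 1 - t := sub_pos.2 ht1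
  by_cases top0 : Ent (Measure.map Q₀ lam) (gm κ) = ⊤
  · rw [top0, EReal.coe_mul_top_of_pos ht1', EReal.top_add_of_ne_bot, ← EReal.coe_mul,
      EReal.top_sub_coe]
    · exact le_top
    · by_cases top1 : Ent (Measure.map Q₁ lam) (gm κ) = ⊤
      · rw [top1, EReal.coe_mul_top_of_pos ht0]; simp
      · lift Ent (Measure.map Q₁ lam) (gm κ) to ℝ using ⟨top1, b1⟩ with e
        rw [← EReal.coe_mul]; exact EReal.coe_ne_bot _
  by_cases top1 : Ent (Measure.map Q₁ lam) (gm κ) = ⊤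
  · rw [top1, EReal.coe_mul_top_of_pos ht0, EReal.add_top_of_ne_bot, ← EReal.coe_mul,
      EReal.top_sub_coe]
    · exact le_top
    · lift Ent (Measure.map Q₀ lam) (gm κ) to ℝ using ⟨top0, b0⟩ with e
      rw [← EReal.coe_mul]; exact EReal.coe_ne_bot _
  have c0 : Measure.map Q₀ lam ≪ gm κ ∧
      Integrable (fun x => max (entFun (Measure.map Q₀ lam) (gm κ) x) 0) (gm κ) := by
    by_contra hc; exact top0 (if_neg hc)
  have c1 : Measure.map Q₁ lam ≪ gm κ ∧
      Integrable (fun x => max (entFun (Measure.map Q₁ lam) (gm κ) x) 0) (gm κ) := by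
    by_contra hc; exact top1 (if_neg hc)
  have st₀ := strict_of_ac m₀ mono₀ c0.1
  have st₁ := strict_of_ac m₁ mono₁ c1.1
  obtain ⟨f1, -, f3⟩ := ent_formula m₀ st₀ c0.1
  obtain ⟨g1, -, g3⟩ := ent_formula m₁ st₁ c1.1
  obtain ⟨i0, e0⟩ := ent_real m₀ st₀ c0.1 (f1.1 c0.2) (f3 ▸ neg_part_finite hκ h₀)
  obtain ⟨i1, e1⟩ := ent_real m₁ st₁ c1.1 (g1.1 c1.2) (g3 ▸ neg_part_finite hκ h₁)
  have stt : StrictMonoOn (Qt Q₀ Q₁ t) (Ioo 0 1) := by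
    intro a ha b hb hab
    exact add_lt_add (mul_lt_mul_of_pos_left (st₀ ha hb hab) ht1')
      (mul_lt_mul_of_pos_left (st₁ ha hb hab) ht0)
  have mt := Qt_meas m₀ m₁ t
  have hder : ∀ᵐ u ∂lam, deriv (Qt Q₀ Q₁ t) u = (1 - t) * deriv Q₀ u + t * deriv Q₁ u := by
    filter_upwards [dset_ae mono₀, dset_ae mono₁] with u hu0 hu1
    exact ((hu0.2.hasDerivAt.const_mul (1 - t)).add (hu1.2.hasDerivAt.const_mul t)).deriv
  have l0 := log_dens m₀ st₀ c0.1
  have l1 := log_dens m₁ st₁ c1.1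
  have hpos : ∀ᵐ u ∂lam, 0 < deriv (Qt Q₀ Q₁ t) u := by
    filter_upwards [hder, l0, l1] with u hu hu0 hu1
    rw [hu]
    exact add_pos (mul_pos ht1' hu0.1) (mul_pos ht0 hu1.1)
  have act : Measure.map (Qt Q₀ Q₁ t) lam ≪ gm κ := (map_ac mt stt hpos).trans (vol_ac_gm κ)
  have j0 := i0.const_mul (1 - t)
  have j1 := i1.const_mul t
  have jd := sd.const_mul (κ / 2 * (t * (1 - t)))
  have main := ent_le (H := fun u => ((1 - t) * Lf κ Q₀ u + t * Lf κ Q₁ u) +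
      κ / 2 * (t * (1 - t)) * (Q₀ u - Q₁ u) ^ 2) mt stt act ((j0.add j1).add jd) (by
    filter_upwards [hder, l0, l1] with u hu hu0 hu1
    have hc := strictConcaveOn_log_Ioi.concaveOn.2 (show deriv Q₀ u ∈ Ioi 0 from hu0.1)
      (show deriv Q₁ u ∈ Ioi 0 from hu1.1) ht1'.le ht0.le (by ring)
    simp only [smul_eq_mul] at hc
    unfold Lf
    rw [hu]
    have hq : κ * Qt Q₀ Q₁ t u ^ 2 / 2 = (1 - t) * (κ * Q₀ u ^ 2 / 2) + t * (κ * Q₁ u ^ 2 / 2)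
        - κ / 2 * (t * (1 - t)) * (Q₀ u - Q₁ u) ^ 2 := by unfold Qt; ring
    rw [hq]
    linarith)
  refine main.trans (le_of_eq ?_)
  rw [e0, e1, ← EReal.coe_mul, ← EReal.coe_mul, ← EReal.coe_mul, ← EReal.coe_add, ← EReal.coe_sub]
  congr 1
  have j01 : Integrable (fun u => (1 - t) * Lf κ Q₀ u + t * Lf κ Q₁ u) lam := j0.add j1
  rw [integral_add j01 jd, integral_add j0 j1, integral_const_mul, integral_const_mul,
    integral_const_mul]
  ring

lemma growth {κ : ℝ} (hκ : 0 < κ) (x R : ℝ) (hR : 1/2 ≤ R) :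
    gm κ (Metric.ball x R) ≥ ENNReal.ofReal (Real.exp (κ / 2 * (R - 1/2) ^ 2)) := by
  set A := Metric.ball x R \ Ioo (-(R - 1/2)) (R - 1/2) with hA
  have mA : MeasurableSet A := measurableSet_ball.diff measurableSet_Ioo
  have vA : 1 ≤ volume A := by
    refine le_trans ?_ le_measure_sdiff
    rw [Real.volume_ball, Real.volume_Ioo, ← ENNReal.ofReal_sub _ (by linarith)]
    rw [← ENNReal.ofReal_one]
    exact ENNReal.ofReal_le_ofReal (by linarith)
  calc ENNReal.ofReal (Real.exp (κ / 2 * (R - 1/2) ^ 2))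
      ≤ ENNReal.ofReal (Real.exp (κ / 2 * (R - 1/2) ^ 2)) * volume A := le_mul_of_one_le_right' vA
    _ = ∫⁻ _ in A, ENNReal.ofReal (Real.exp (κ / 2 * (R - 1/2) ^ 2)) := by
        rw [setLIntegral_const]
    _ ≤ ∫⁻ y in A, ENNReal.ofReal (Real.exp (κ * y ^ 2 / 2)) := by
        refine setLIntegral_mono' mA fun y hy => ENNReal.ofReal_le_ofReal (Real.exp_le_exp.2 ?_)
        have hy2 : (R - 1/2) ^ 2 ≤ y ^ 2 := by
          have h : ¬ (-(R - 1/2) < y ∧ y < R - 1/2) := hy.2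
          rw [← abs_lt, not_lt] at h
          exact sq_le_sq.2 (by rwa [abs_of_nonneg (by linarith : (0:ℝ) ≤ R - 1/2)])
        nlinarith
    _ = gm κ A := (withDensity_apply _ mA).symm
    _ ≤ gm κ (Metric.ball x R) := measure_mono sdiff_subset

/-- **Sharpness of the volume growth estimate:** `(ℝ, |·|, e^{κ x²/2} dx)` satisfies
`CD(-κ, ∞)` and has `m(B_R(x)) ≥ exp((κ/2)(R - 1/2)²)` for `R ≥ 1/2`. -/
theorem gaussian_weight_CD_and_growth (κ : ℝ) (hκ : 0 < κ) :
    CDinfty (-κ)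
      ((volume : Measure ℝ).withDensity fun x => ENNReal.ofReal (Real.exp (κ * x ^ 2 / 2))) ∧
    ∀ x R : ℝ, 1/2 ≤ R →
      ((volume : Measure ℝ).withDensity fun x => ENNReal.ofReal (Real.exp (κ * x ^ 2 / 2)))
          (Metric.ball x R) ≥
        ENNReal.ofReal (Real.exp (κ / 2 * (R - 1/2) ^ 2)) := by
  exact ⟨cd_main hκ, fun x R hR => growth hκ x R hR⟩

end
end
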